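/- arXiv:2605.04386 — 4 statements merged into one kernel-verified Lean document; each statement's English description precedes it below -/
import Mathlib

section
/- (Basic energy identity for the Kazhikhov model.) Every strong solution (v,u) of (K) on [0,T] with initial data (v₀,u₀) satisfying the standing initial-data hypotheses satisfies, for all t ∈ [0,T], the identity ∫₀^∞ ( Φ(v(t,x)) + u(t,x)²/2 + r(t,x)^{2m} v_x(t,x)² / (2 v(t,x)^{β+5}) ) dx + ∫₀ᵗ ∫₀^∞ (2μ̃ + λ̃ v^{−α}) ((r^m u)_x)² / v dx dτ = ∫₀^∞ ( Φ(v₀(x)) + u₀(x)²/2 + r(0,x)^{2m} v₀′(x)² / (2 v₀(x)^{β+5}) ) dx. -/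
open MeasureTheory Real Filter Topology Set

noncomputable section

/-- The pressure potential `Φ(v) = ∫₁^v (1 - s^(-γ)) ds`. -/
def Phi (γ v : ℝ) : ℝ := ∫ s in (1:ℝ)..v, (1 - s ^ (-γ))

/-- Squared `L²` norm over `(0, ∞)`. -/
def L2sq (f : ℝ → ℝ) : ℝ := ∫ x in Ioi (0:ℝ), f x ^ 2

/-- Squared weighted `L²` norm over `(0, ∞)`, with weight `r(x) ^ (2m)`. -/
def L2sqW (m : ℝ) (r f : ℝ → ℝ) : ℝ := ∫ x in Ioi (0:ℝ), r x ^ (2 * m) * f x ^ 2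

/-- The fixed data of the model: dimension `d ≥ 2`, boundary radius `a > 0`,
viscosity constants `μ̃`, `λ̃`, and exponents `α`, `β`, `γ`. -/
structure KParams where
  d : ℕ
  hd : 2 ≤ d
  a : ℝ
  ha : 0 < a
  mu : ℝ
  hmu : 0 < mu
  lam : ℝ
  hlam : 0 < lam
  α : ℝ
  β : ℝ
  γ : ℝ

namespace KParams

/-- `m = d - 1` (as a real number). -/
def m (P : KParams) : ℝ := (P.d : ℝ) - 1

/-- The initial radial coordinate `r(0,x)`, determined by the initial specific volume
through the Lagrangian relation `r(0,x)^(m+1) = a^(m+1) + (m+1) ∫₀ˣ v₀`. -/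
def r0 (P : KParams) (v₀ : ℝ → ℝ) (x : ℝ) : ℝ :=
  (P.a ^ (P.m + 1) + (P.m + 1) * ∫ y in (0:ℝ)..x, v₀ y) ^ (1 / (P.m + 1))

end KParams

/-- Parameter case (i) of the Kazhikhov model. -/
def KCaseI (P : KParams) : Prop := -3 ≤ P.β ∧ P.β ≤ -2 ∧ 1 ≤ P.γ

/-- Parameter case (ii) of the Kazhikhov model. -/
def KCaseII (P : KParams) : Prop :=
  (P.β + 2 - Real.sqrt (-2 * (P.β + 2) * (P.β + 5))) / 2 < P.α ∧ P.α ≤ P.β + 3 ∧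
    (-7 - Real.sqrt 3) / 2 ≤ P.β ∧ P.β < -3 ∧ -P.β - 2 < P.γ

/-- Parameter case (iii) of the Kazhikhov model. -/
def KCaseIII (P : KParams) : Prop :=
  (-3 - Real.sqrt (-2 * P.β ^ 2 - 22 * P.β - 59)) / 2 < P.α ∧ P.α ≤ P.β + 3 ∧
    -5 ≤ P.β ∧ P.β ≤ -14 / 3 ∧ -P.β - 2 < P.γ

/-- The standing parameter hypotheses of the Kazhikhov model. -/
def KCase (P : KParams) : Prop := KCaseI P ∨ KCaseII P ∨ KCaseIII P

/-- Standing initial-data hypotheses (with the weighted `L²` norm of `v₀'` finite). -/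
structure InitData1 (P : KParams) (v₀ u₀ : ℝ → ℝ) (Vlo Vhi : ℝ) : Prop where
  hVlo : 0 < Vlo
  hv₀diff : ∀ x : ℝ, DifferentiableAt ℝ v₀ x ∧ DifferentiableAt ℝ (deriv v₀) x
  hu₀diff : ∀ x : ℝ, DifferentiableAt ℝ u₀ x
  hbdd : ∀ x : ℝ, 0 ≤ x → Vlo ≤ v₀ x ∧ v₀ x ≤ Vhi
  hv₀L2 : IntegrableOn (fun x => (v₀ x - 1) ^ 2) (Ioi (0:ℝ))
  hv₀xL2 : IntegrableOn (fun x => deriv v₀ x ^ 2) (Ioi (0:ℝ))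
  hu₀L2 : IntegrableOn (fun x => u₀ x ^ 2) (Ioi (0:ℝ))
  hu₀xL2 : IntegrableOn (fun x => deriv u₀ x ^ 2) (Ioi (0:ℝ))
  hv₀xW : IntegrableOn (fun x => P.r0 v₀ x ^ (2 * P.m) * deriv v₀ x ^ 2) (Ioi (0:ℝ))
  hv₀x0 : deriv v₀ 0 = 0
  hu₀0 : u₀ 0 = 0
  hfar_v : Tendsto v₀ atTop (𝓝 1)
  hfar_u : Tendsto u₀ atTop (𝓝 0)

/-- Standing initial-data hypotheses (with the weighted `H¹` norm of `v₀'` finite). -/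
structure InitData2 (P : KParams) (v₀ u₀ : ℝ → ℝ) (Vlo Vhi : ℝ)
    extends InitData1 P v₀ u₀ Vlo Vhi : Prop where
  hv₀xxW : IntegrableOn (fun x => P.r0 v₀ x ^ (2 * P.m) * deriv (deriv v₀) x ^ 2) (Ioi (0:ℝ))

/-- A strong solution of the system on `[0,T] × [0,∞)` in Lagrangian coordinates.
The relevant partial derivatives of `v` and `u`, the derivative `Wx` of the capillary flux
`r^(2m) v^(-(β+5)) v_x`, and the derivative `Qx` of the full bracket in the momentum
equation are recorded as data, constrained by `HasDerivAt` conditions.  By the mass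
equation, `vt = (r^m u)_x` and `vtx = (r^m u)_xx`.  The final group of fields expresses
that all integrals appearing in the estimates are finite. -/
structure SolK (P : KParams) (T : ℝ) (v₀ u₀ : ℝ → ℝ) where
  v : ℝ → ℝ → ℝ
  u : ℝ → ℝ → ℝ
  r : ℝ → ℝ → ℝ
  vt : ℝ → ℝ → ℝ
  vx : ℝ → ℝ → ℝ
  vxx : ℝ → ℝ → ℝ
  vxxx : ℝ → ℝ → ℝ
  vtx : ℝ → ℝ → ℝ
  ut : ℝ → ℝ → ℝ
  ux : ℝ → ℝ → ℝ
  uxx : ℝ → ℝ → ℝ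
  Wx : ℝ → ℝ → ℝ
  Qx : ℝ → ℝ → ℝ
  v_pos : ∀ t ∈ Icc (0:ℝ) T, ∀ x ∈ Ici (0:ℝ), 0 < v t x
  v_bdd : ∃ c C : ℝ, 0 < c ∧ ∀ t ∈ Icc (0:ℝ) T, ∀ x ∈ Ici (0:ℝ), c ≤ v t x ∧ v t x ≤ C
  cont_v : ContinuousOn (fun p : ℝ × ℝ => v p.1 p.2) (Icc (0:ℝ) T ×ˢ Ici (0:ℝ))
  cont_u : ContinuousOn (fun p : ℝ × ℝ => u p.1 p.2) (Icc (0:ℝ) T ×ˢ Ici (0:ℝ))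
  cont_vt : ContinuousOn (fun p : ℝ × ℝ => vt p.1 p.2) (Icc (0:ℝ) T ×ˢ Ici (0:ℝ))
  cont_vx : ContinuousOn (fun p : ℝ × ℝ => vx p.1 p.2) (Icc (0:ℝ) T ×ˢ Ici (0:ℝ))
  cont_vxx : ContinuousOn (fun p : ℝ × ℝ => vxx p.1 p.2) (Icc (0:ℝ) T ×ˢ Ici (0:ℝ))
  cont_vxxx : ContinuousOn (fun p : ℝ × ℝ => vxxx p.1 p.2) (Icc (0:ℝ) T ×ˢ Ici (0:ℝ))
  cont_vtx : ContinuousOn (fun p : ℝ × ℝ => vtx p.1 p.2) (Icc (0:ℝ) T ×ˢ Ici (0:ℝ))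
  cont_ut : ContinuousOn (fun p : ℝ × ℝ => ut p.1 p.2) (Icc (0:ℝ) T ×ˢ Ici (0:ℝ))
  cont_ux : ContinuousOn (fun p : ℝ × ℝ => ux p.1 p.2) (Icc (0:ℝ) T ×ˢ Ici (0:ℝ))
  cont_uxx : ContinuousOn (fun p : ℝ × ℝ => uxx p.1 p.2) (Icc (0:ℝ) T ×ˢ Ici (0:ℝ))
  r_ge : ∀ t ∈ Icc (0:ℝ) T, ∀ x ∈ Ici (0:ℝ), P.a ≤ r t x
  r_t : ∀ t ∈ Icc (0:ℝ) T, ∀ x ∈ Ici (0:ℝ), HasDerivAt (fun τ => r τ x) (u t x) t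
  r_x : ∀ t ∈ Icc (0:ℝ) T, ∀ x ∈ Ici (0:ℝ),
    HasDerivAt (fun y => r t y) (v t x * r t x ^ (-P.m)) x
  r_bd : ∀ t ∈ Icc (0:ℝ) T, r t 0 = P.a
  hvt : ∀ t ∈ Icc (0:ℝ) T, ∀ x ∈ Ici (0:ℝ), HasDerivAt (fun τ => v τ x) (vt t x) t
  hvx : ∀ t ∈ Icc (0:ℝ) T, ∀ x ∈ Ici (0:ℝ), HasDerivAt (fun y => v t y) (vx t x) x
  hvxx : ∀ t ∈ Icc (0:ℝ) T, ∀ x ∈ Ici (0:ℝ), HasDerivAt (fun y => vx t y) (vxx t x) x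
  hvxxx : ∀ t ∈ Icc (0:ℝ) T, ∀ x ∈ Ici (0:ℝ), HasDerivAt (fun y => vxx t y) (vxxx t x) x
  hvtx : ∀ t ∈ Icc (0:ℝ) T, ∀ x ∈ Ici (0:ℝ), HasDerivAt (fun τ => vx τ x) (vtx t x) t
  hut : ∀ t ∈ Icc (0:ℝ) T, ∀ x ∈ Ici (0:ℝ), HasDerivAt (fun τ => u τ x) (ut t x) t
  hux : ∀ t ∈ Icc (0:ℝ) T, ∀ x ∈ Ici (0:ℝ), HasDerivAt (fun y => u t y) (ux t x) x
  huxx : ∀ t ∈ Icc (0:ℝ) T, ∀ x ∈ Ici (0:ℝ), HasDerivAt (fun y => ux t y) (uxx t x) x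
  mass : ∀ t ∈ Icc (0:ℝ) T, ∀ x ∈ Ici (0:ℝ),
    HasDerivAt (fun y => r t y ^ P.m * u t y) (vt t x) x
  hWx : ∀ t ∈ Icc (0:ℝ) T, ∀ x ∈ Ici (0:ℝ),
    HasDerivAt (fun y => r t y ^ (2 * P.m) * v t y ^ (-(P.β + 5)) * vx t y) (Wx t x) x
  hQx : ∀ t ∈ Icc (0:ℝ) T, ∀ x ∈ Ici (0:ℝ),
    HasDerivAt (fun y =>
      (2 * P.mu + P.lam * v t y ^ (-P.α)) * vt t y / v t y - Wx t y
        - (P.β + 5) / 2 * r t y ^ (2 * P.m) * v t y ^ (-(P.β + 6)) * vx t y ^ 2)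
      (Qx t x) x
  momentum : ∀ t ∈ Icc (0:ℝ) T, ∀ x ∈ Ici (0:ℝ),
    ut t x + r t x ^ P.m * (-P.γ * v t x ^ (-P.γ - 1) * vx t x)
      = r t x ^ P.m * Qx t x
        - P.m * r t x ^ (2 * P.m - 1) * v t x ^ (-(P.β + 5)) * vx t x ^ 2
  init_v : ∀ x ∈ Ici (0:ℝ), v 0 x = v₀ x
  init_u : ∀ x ∈ Ici (0:ℝ), u 0 x = u₀ x
  bd_vx : ∀ t ∈ Icc (0:ℝ) T, vx t 0 = 0
  bd_u : ∀ t ∈ Icc (0:ℝ) T, u t 0 = 0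
  far_v : ∀ t ∈ Icc (0:ℝ) T, Tendsto (fun x => v t x) atTop (𝓝 1)
  far_u : ∀ t ∈ Icc (0:ℝ) T, Tendsto (fun x => u t x) atTop (𝓝 0)
  int_v1 : ∀ t ∈ Icc (0:ℝ) T, IntegrableOn (fun x => (v t x - 1) ^ 2) (Ioi (0:ℝ))
  int_vx : ∀ t ∈ Icc (0:ℝ) T, IntegrableOn (fun x => vx t x ^ 2) (Ioi (0:ℝ))
  int_u : ∀ t ∈ Icc (0:ℝ) T, IntegrableOn (fun x => u t x ^ 2) (Ioi (0:ℝ))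
  int_ux : ∀ t ∈ Icc (0:ℝ) T, IntegrableOn (fun x => ux t x ^ 2) (Ioi (0:ℝ))
  int_vt : ∀ t ∈ Icc (0:ℝ) T, IntegrableOn (fun x => vt t x ^ 2) (Ioi (0:ℝ))
  int_vtx : ∀ t ∈ Icc (0:ℝ) T, IntegrableOn (fun x => vtx t x ^ 2) (Ioi (0:ℝ))
  int_vtr : ∀ t ∈ Icc (0:ℝ) T, IntegrableOn (fun x => (vt t x / r t x ^ P.m) ^ 2) (Ioi (0:ℝ))
  int_wvx : ∀ t ∈ Icc (0:ℝ) T, IntegrableOn (fun x => r t x ^ (2 * P.m) * vx t x ^ 2) (Ioi (0:ℝ))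
  int_wvxx : ∀ t ∈ Icc (0:ℝ) T,
    IntegrableOn (fun x => r t x ^ (2 * P.m) * vxx t x ^ 2) (Ioi (0:ℝ))
  int_wvxxx : ∀ t ∈ Icc (0:ℝ) T,
    IntegrableOn (fun x => r t x ^ (2 * P.m) * vxxx t x ^ 2) (Ioi (0:ℝ))
  int_wux : ∀ t ∈ Icc (0:ℝ) T, IntegrableOn (fun x => r t x ^ (2 * P.m) * ux t x ^ 2) (Ioi (0:ℝ))
  int_wuxx : ∀ t ∈ Icc (0:ℝ) T,
    IntegrableOn (fun x => r t x ^ (2 * P.m) * uxx t x ^ 2) (Ioi (0:ℝ))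
  int_Phi : ∀ t ∈ Icc (0:ℝ) T, IntegrableOn (fun x => Phi P.γ (v t x)) (Ioi (0:ℝ))
  int_wvxB : ∀ t ∈ Icc (0:ℝ) T,
    IntegrableOn (fun x => r t x ^ (2 * P.m) * vx t x ^ 2 / v t x ^ (P.β + 5)) (Ioi (0:ℝ))
  int_vxa : ∀ t ∈ Icc (0:ℝ) T,
    IntegrableOn (fun x => vx t x ^ 2 / v t x ^ (2 * P.α + 2)) (Ioi (0:ℝ))
  int_vxb : ∀ t ∈ Icc (0:ℝ) T,
    IntegrableOn (fun x => vx t x ^ 2 / v t x ^ (P.α + 2)) (Ioi (0:ℝ))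
  int_vxc : ∀ t ∈ Icc (0:ℝ) T,
    IntegrableOn (fun x => vx t x ^ 2 / v t x ^ (P.α + P.γ + 2)) (Ioi (0:ℝ))
  int_wvxxab : ∀ t ∈ Icc (0:ℝ) T,
    IntegrableOn (fun x => r t x ^ (2 * P.m) * vxx t x ^ 2 / v t x ^ (P.α + P.β + 6))
      (Ioi (0:ℝ))
  int_wvxxxb : ∀ t ∈ Icc (0:ℝ) T,
    IntegrableOn (fun x => r t x ^ (2 * P.m) * vxxx t x ^ 2 / v t x ^ (P.β + 5)) (Ioi (0:ℝ))
  int_G : ∀ t ∈ Icc (0:ℝ) T,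
    IntegrableOn (fun x =>
      (P.m * v t x ^ (1 - (P.α + P.β + 6) / 2) * vx t x / r t x
        + r t x ^ P.m * v t x ^ (-((P.α + P.β + 6) / 2)) * vxx t x
        - (P.α + P.β + 6) / 2 * r t x ^ P.m * v t x ^ (-((P.α + P.β + 6) / 2) - 1)
            * vx t x ^ 2) ^ 2) (Ioi (0:ℝ))
  tint_vx : IntervalIntegrable (fun τ => ∫ x in Ioi (0:ℝ), vx τ x ^ 2) volume 0 T
  tint_vt : IntervalIntegrable (fun τ => ∫ x in Ioi (0:ℝ), vt τ x ^ 2) volume 0 T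
  tint_vtx : IntervalIntegrable (fun τ => ∫ x in Ioi (0:ℝ), vtx τ x ^ 2) volume 0 T
  tint_wvxx : IntervalIntegrable
    (fun τ => ∫ x in Ioi (0:ℝ), r τ x ^ (2 * P.m) * vxx τ x ^ 2) volume 0 T
  tint_wvxxx : IntervalIntegrable
    (fun τ => ∫ x in Ioi (0:ℝ), r τ x ^ (2 * P.m) * vxxx τ x ^ 2) volume 0 T
  tint_wux : IntervalIntegrable
    (fun τ => ∫ x in Ioi (0:ℝ), r τ x ^ (2 * P.m) * ux τ x ^ 2) volume 0 T
  tint_wuxx : IntervalIntegrable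
    (fun τ => ∫ x in Ioi (0:ℝ), r τ x ^ (2 * P.m) * uxx τ x ^ 2) volume 0 T
  tint_vxc : IntervalIntegrable
    (fun τ => ∫ x in Ioi (0:ℝ), vx τ x ^ 2 / v τ x ^ (P.α + P.γ + 2)) volume 0 T
  tint_wvxxab : IntervalIntegrable
    (fun τ => ∫ x in Ioi (0:ℝ), r τ x ^ (2 * P.m) * vxx τ x ^ 2 / v τ x ^ (P.α + P.β + 6))
    volume 0 T
  tint_wvxxxb : IntervalIntegrable
    (fun τ => ∫ x in Ioi (0:ℝ), r τ x ^ (2 * P.m) * vxxx τ x ^ 2 / v τ x ^ (P.β + 5))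
    volume 0 T
  tint_G : IntervalIntegrable
    (fun τ => ∫ x in Ioi (0:ℝ),
      (P.m * v τ x ^ (1 - (P.α + P.β + 6) / 2) * vx τ x / r τ x
        + r τ x ^ P.m * v τ x ^ (-((P.α + P.β + 6) / 2)) * vxx τ x
        - (P.α + P.β + 6) / 2 * r τ x ^ P.m * v τ x ^ (-((P.α + P.β + 6) / 2) - 1)
            * vx τ x ^ 2) ^ 2) volume 0 T
  int_diss : ∀ t ∈ Icc (0:ℝ) T,
    IntegrableOn (fun x => (2 * P.mu + P.lam * v t x ^ (-P.α)) * vt t x ^ 2 / v t x) (Ioi (0:ℝ))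
  tint_diss : IntervalIntegrable
    (fun τ => ∫ x in Ioi (0:ℝ), (2 * P.mu + P.lam * v τ x ^ (-P.α)) * vt τ x ^ 2 / v τ x)
    volume 0 T

/-- The spatial derivative `(r^m v_x / v^((α+β+6)/2))_x`, computed by the chain rule
using `r_x = v r^(-m)`. -/
def SolK.G {P : KParams} {T : ℝ} {v₀ u₀ : ℝ → ℝ} (S : SolK P T v₀ u₀) (t x : ℝ) : ℝ :=
  P.m * S.v t x ^ (1 - (P.α + P.β + 6) / 2) * S.vx t x / S.r t x
    + S.r t x ^ P.m * S.v t x ^ (-((P.α + P.β + 6) / 2)) * S.vxx t x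
    - (P.α + P.β + 6) / 2 * S.r t x ^ P.m * S.v t x ^ (-((P.α + P.β + 6) / 2) - 1)
        * S.vx t x ^ 2

/-- `‖v₀ - 1‖₁²`. -/
def InitH1v (v₀ : ℝ → ℝ) : ℝ := L2sq (fun x => v₀ x - 1) + L2sq (deriv v₀)

/-- `‖u₀‖₁²`. -/
def InitH1u (u₀ : ℝ → ℝ) : ℝ := L2sq u₀ + L2sq (deriv u₀)

/-- `‖v₀'‖_(0,r)²`. -/
def InitW0 (P : KParams) (v₀ : ℝ → ℝ) : ℝ := L2sqW P.m (P.r0 v₀) (deriv v₀)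

/-- `‖v₀'‖_(1,r)²`. -/
def InitW1 (P : KParams) (v₀ : ℝ → ℝ) : ℝ :=
  L2sqW P.m (P.r0 v₀) (deriv v₀) + L2sqW P.m (P.r0 v₀) (deriv (deriv v₀))

/-- `‖(r(0,·)^m u₀)_x / r(0,·)^m‖²`, computed via `(r0^m u₀)_x / r0^m = m v₀ u₀ / r0^(m+1) + u₀'`. -/
def InitU1 (P : KParams) (v₀ u₀ : ℝ → ℝ) : ℝ :=
  L2sq (fun x => P.m * v₀ x * u₀ x / P.r0 v₀ x ^ (P.m + 1) + deriv u₀ x)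

/-- Clamping the arguments turns a function continuous on the strip into a continuous one. -/
lemma continuous_clamp {f : ℝ → ℝ → ℝ} {T : ℝ} (hT : 0 ≤ T)
    (hf : ContinuousOn (fun p : ℝ × ℝ => f p.1 p.2) (Icc (0:ℝ) T ×ˢ Ici (0:ℝ))) :
    Continuous fun p : ℝ × ℝ => f (max 0 (min T p.1)) (max 0 p.2) := by
  have hg : Continuous fun p : ℝ × ℝ => ((max 0 (min T p.1), max 0 p.2) : ℝ × ℝ) := by fun_prop
  exact hf.comp_continuous hg fun p =>
    ⟨⟨le_max_left _ _, max_le hT (min_le_left _ _)⟩, mem_Ici.2 (le_max_left _ _)⟩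

lemma clamp_eq {T t : ℝ} (ht : t ∈ Icc (0:ℝ) T) : max 0 (min T t) = t := by
  rw [min_eq_right ht.2, max_eq_right ht.1]

lemma continuousOn_primitive {f : ℝ → ℝ → ℝ} {T : ℝ} (hT : 0 ≤ T)
    (hf : ContinuousOn (fun p : ℝ × ℝ => f p.1 p.2) (Icc (0:ℝ) T ×ˢ Ici (0:ℝ))) :
    ContinuousOn (fun p : ℝ × ℝ => ∫ x in (0:ℝ)..p.2, f p.1 x) (Icc (0:ℝ) T ×ˢ Ici (0:ℝ)) := by
  have h := intervalIntegral.continuous_parametric_primitive_of_continuous (μ := volume) (a₀ := 0)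
    (f := fun t x => f (max 0 (min T t)) (max 0 x)) (continuous_clamp hT hf)
  refine h.continuousOn.congr fun p hp => ?_
  refine intervalIntegral.integral_congr fun x hx => ?_
  rw [uIcc_of_le hp.2] at hx
  simp only [clamp_eq hp.1, max_eq_right hx.1]

lemma continuousOn_slice {f : ℝ → ℝ → ℝ} {T t : ℝ}
    (hf : ContinuousOn (fun p : ℝ × ℝ => f p.1 p.2) (Icc (0:ℝ) T ×ˢ Ici (0:ℝ)))
    (ht : t ∈ Icc (0:ℝ) T) : ContinuousOn (f t) (Ici (0:ℝ)) :=
  hf.comp (f := fun x => ((t, x) : ℝ × ℝ)) (by fun_prop) fun _ hx => ⟨ht, hx⟩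

lemma intervalIntegrable_of_continuousOn_Ici {g : ℝ → ℝ} (hg : ContinuousOn g (Ici (0:ℝ)))
    {R : ℝ} (hR : 0 ≤ R) : IntervalIntegrable g volume 0 R :=
  (hg.mono (by rw [uIcc_of_le hR]; exact Icc_subset_Ici_self)).intervalIntegrable

lemma continuousOn_integral_slice {f : ℝ → ℝ → ℝ} {T R : ℝ} (hR : 0 ≤ R) (hT : 0 ≤ T)
    (hf : ContinuousOn (fun p : ℝ × ℝ => f p.1 p.2) (Icc (0:ℝ) T ×ˢ Ici (0:ℝ))) :
    ContinuousOn (fun t => ∫ x in (0:ℝ)..R, f t x) (Icc (0:ℝ) T) :=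
  (continuousOn_primitive hT hf).comp (f := fun t => ((t, R) : ℝ × ℝ)) (by fun_prop)
    fun _ ht => ⟨ht, hR⟩

lemma hasDerivAt_integral_slice {f ft : ℝ → ℝ → ℝ} {T R t : ℝ} (hR : 0 ≤ R)
    (hf : ContinuousOn (fun p : ℝ × ℝ => f p.1 p.2) (Icc (0:ℝ) T ×ˢ Ici (0:ℝ)))
    (hft : ContinuousOn (fun p : ℝ × ℝ => ft p.1 p.2) (Icc (0:ℝ) T ×ˢ Ici (0:ℝ)))
    (hd : ∀ t ∈ Icc (0:ℝ) T, ∀ x ∈ Ici (0:ℝ), HasDerivAt (fun τ => f τ x) (ft t x) t)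
    (ht : t ∈ Ioo (0:ℝ) T) :
    HasDerivAt (fun τ => ∫ x in (0:ℝ)..R, f τ x) (∫ x in (0:ℝ)..R, ft t x) t := by
  obtain ⟨K, hK⟩ := ((isCompact_Icc (a := (0:ℝ)) (b := T)).prod
    (isCompact_Icc (a := (0:ℝ)) (b := R))).exists_bound_of_continuousOn
    (hft.mono (prod_mono_right Icc_subset_Ici_self))
  have hs : Ioo (0:ℝ) T ∈ 𝓝 t := Ioo_mem_nhds ht.1 ht.2
  have hint : ∀ g : ℝ → ℝ → ℝ,
      ContinuousOn (fun p : ℝ × ℝ => g p.1 p.2) (Icc (0:ℝ) T ×ˢ Ici (0:ℝ)) →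
      ∀ τ ∈ Ioo (0:ℝ) T, IntervalIntegrable (g τ) volume 0 R := fun g hg τ hτ =>
    intervalIntegrable_of_continuousOn_Ici (continuousOn_slice hg (Ioo_subset_Icc_self hτ)) hR
  refine (intervalIntegral.hasDerivAt_integral_of_dominated_loc_of_deriv_le (F := f) (F' := ft)
    (bound := fun _ => K) hs ?_ (hint f hf t ht) ?_ ?_ ?_ ?_).2
  · filter_upwards [hs] with τ hτ
    exact (hint f hf τ hτ).def'.aestronglyMeasurable
  · exact (hint ft hft t ht).def'.aestronglyMeasurable
  · refine ae_of_all _ fun x hx τ hτ => ?_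
    rw [uIoc_of_le hR] at hx
    exact hK (τ, x) ⟨Ioo_subset_Icc_self hτ, Ioc_subset_Icc_self hx⟩
  · exact intervalIntegrable_const
  · refine ae_of_all _ fun x hx τ hτ => ?_
    rw [uIoc_of_le hR] at hx
    exact hd τ (Ioo_subset_Icc_self hτ) x hx.1.le

lemma hasDerivAt_primitive_Ici {g : ℝ → ℝ} (hg : ContinuousOn g (Ici (0:ℝ))) {x : ℝ}
    (hx : 0 < x) : HasDerivAt (fun y => ∫ z in (0:ℝ)..y, g z) (g x) x :=
  intervalIntegral.integral_hasDerivAt_right (intervalIntegrable_of_continuousOn_Ici hg hx.le)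
    ((hg.mono Ioi_subset_Ici_self).stronglyMeasurableAtFilter isOpen_Ioi x hx)
    (hg.continuousAt (Ici_mem_nhds hx))

/-- Equality of mixed partial derivatives: `∂ₓ fₜ = ∂ₜ fₓ`. -/
lemma hasDerivAt_mixed {f ft fx ftx : ℝ → ℝ → ℝ} {T t x : ℝ}
    (hfx : ContinuousOn (fun p : ℝ × ℝ => fx p.1 p.2) (Icc (0:ℝ) T ×ˢ Ici (0:ℝ)))
    (hftx : ContinuousOn (fun p : ℝ × ℝ => ftx p.1 p.2) (Icc (0:ℝ) T ×ˢ Ici (0:ℝ)))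
    (dft : ∀ t ∈ Icc (0:ℝ) T, ∀ x ∈ Ici (0:ℝ), HasDerivAt (fun τ => f τ x) (ft t x) t)
    (dfx : ∀ t ∈ Icc (0:ℝ) T, ∀ x ∈ Ici (0:ℝ), HasDerivAt (f t) (fx t x) x)
    (dftx : ∀ t ∈ Icc (0:ℝ) T, ∀ x ∈ Ici (0:ℝ), HasDerivAt (fun τ => fx τ x) (ftx t x) t)
    (ht : t ∈ Ioo (0:ℝ) T) (hx : 0 < x) : HasDerivAt (ft t) (ftx t x) x := by
  have key : ∀ y ∈ Ici (0:ℝ), ft t y = ft t 0 + ∫ z in (0:ℝ)..y, ftx t z := by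
    intro y hy
    have h1 := hasDerivAt_integral_slice hy hfx hftx dftx ht
    have h2 : (fun τ => ∫ z in (0:ℝ)..y, fx τ z) =ᶠ[𝓝 t] fun τ => f τ y - f τ 0 := by
      filter_upwards [Ioo_mem_nhds ht.1 ht.2] with τ hτ
      have hτ' := Ioo_subset_Icc_self hτ
      refine intervalIntegral.integral_eq_sub_of_hasDerivAt (fun z hz => ?_)
        (intervalIntegrable_of_continuousOn_Ici (continuousOn_slice hfx hτ') hy)
      rw [uIcc_of_le hy] at hz
      exact dfx τ hτ' z hz.1
    have ht' := Ioo_subset_Icc_self ht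
    have h3 := ((dft t ht' y hy).sub (dft t ht' 0 self_mem_Ici)).unique
      (h1.congr_of_eventuallyEq h2.symm)
    linarith
  have h := (hasDerivAt_primitive_Ici (continuousOn_slice hftx (Ioo_subset_Icc_self ht)) hx).const_add
    (ft t 0)
  refine h.congr_of_eventuallyEq ?_
  filter_upwards [Ioi_mem_nhds hx] with y hy using key y (mem_Ici.2 (le_of_lt hy))

/-- Cauchy--Schwarz on `[0, x]`. -/
lemma sq_integral_le {g : ℝ → ℝ} (hg : ContinuousOn g (Ici (0:ℝ))) {x : ℝ} (hx : 0 ≤ x) :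
    (∫ y in (0:ℝ)..x, g y) ^ 2 ≤ x * ∫ y in (0:ℝ)..x, g y ^ 2 := by
  rcases hx.eq_or_lt with rfl | hx'
  · simp
  have i1 := intervalIntegrable_of_continuousOn_Ici hg hx
  have i2 : IntervalIntegrable (fun y => g y ^ 2) volume 0 x :=
    intervalIntegrable_of_continuousOn_Ici (hg.pow 2) hx
  set I := ∫ y in (0:ℝ)..x, g y
  have h : 0 ≤ ∫ y in (0:ℝ)..x, (g y ^ 2 - 2 * (I / x) * g y + (I / x) ^ 2) :=
    intervalIntegral.integral_nonneg hx fun y _ => by nlinarith [sq_nonneg (g y - I / x)]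
  rw [intervalIntegral.integral_add (i2.sub (i1.const_mul _)) intervalIntegrable_const,
    intervalIntegral.integral_sub i2 (i1.const_mul _), intervalIntegral.integral_const_mul,
    intervalIntegral.integral_const, smul_eq_mul] at h
  have h2 : x * ((∫ y in (0:ℝ)..x, g y ^ 2) - 2 * (I / x) * I + (x - 0) * (I / x) ^ 2)
      = x * (∫ y in (0:ℝ)..x, g y ^ 2) - I ^ 2 := by
    field_simp; ring
  nlinarith [mul_nonneg hx h]

lemma integral_sq_le_Ioi {g : ℝ → ℝ} (hg : IntegrableOn (fun x => g x ^ 2) (Ioi (0:ℝ)))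
    {x : ℝ} (hx : 0 ≤ x) : ∫ y in (0:ℝ)..x, g y ^ 2 ≤ ∫ y in Ioi (0:ℝ), g y ^ 2 := by
  rw [intervalIntegral.integral_of_le hx]
  exact setIntegral_mono_set hg (ae_of_all _ fun y => sq_nonneg _)
    (Ioc_subset_Ioi_self.eventuallyLE)

lemma hasDerivAt_Phi (γ : ℝ) {v : ℝ} (hv : 0 < v) :
    HasDerivAt (Phi γ) (1 - v ^ (-γ)) v := by
  have hc : ContinuousOn (fun s : ℝ => 1 - s ^ (-γ)) (Ioi 0) :=
    continuousOn_const.sub (continuousOn_id.rpow_const fun s hs => Or.inl (ne_of_gt hs))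
  refine intervalIntegral.integral_hasDerivAt_right (ContinuousOn.intervalIntegrable (hc.mono ?_))
    (hc.stronglyMeasurableAtFilter isOpen_Ioi v hv) (hc.continuousAt (Ioi_mem_nhds hv))
  intro s hs
  exact lt_of_lt_of_le (lt_min one_pos hv) hs.1

lemma Phi_nonneg {γ v : ℝ} (hγ : 0 ≤ γ) (hv : 0 < v) : 0 ≤ Phi γ v := by
  unfold Phi
  rcases le_total 1 v with h | h
  · refine intervalIntegral.integral_nonneg h fun s hs => ?_
    linarith [Real.rpow_le_one_of_one_le_of_nonpos hs.1 (neg_nonpos.2 hγ)]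
  · rw [intervalIntegral.integral_symm, ← intervalIntegral.integral_neg]
    refine intervalIntegral.integral_nonneg h fun s hs => ?_
    linarith [Real.one_le_rpow_of_pos_of_le_one_of_nonpos (lt_of_lt_of_le hv hs.1) hs.2
      (neg_nonpos.2 hγ)]

lemma exists_rpow_le {c C : ℝ} (hc : 0 < c) (p : ℝ) :
    ∃ K : ℝ, ∀ v ∈ Icc c C, v ^ p ≤ K := by
  obtain ⟨K, hK⟩ := (isCompact_Icc (a := c) (b := C)).exists_bound_of_continuousOn
    (f := fun v : ℝ => v ^ p)
    (continuousOn_id.rpow_const fun s hs => Or.inl (ne_of_gt (lt_of_lt_of_le hc hs.1)))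
  exact ⟨K, fun v hv => (le_abs_self _).trans (hK v hv)⟩

lemma exists_one_sub_rpow_le {c C : ℝ} (hc : 0 < c) (p : ℝ) :
    ∃ K : ℝ, ∀ v ∈ Icc c C, |1 - v ^ p| ≤ K * |v - 1| := by
  have hc' : 0 < min c 1 := lt_min hc one_pos
  obtain ⟨K, hK⟩ := (isCompact_Icc (a := min c 1) (b := max C 1)).exists_bound_of_continuousOn
    (f := fun v : ℝ => p * v ^ (p - 1))
    (continuousOn_const.mul
      (continuousOn_id.rpow_const fun s hs => Or.inl (ne_of_gt (lt_of_lt_of_le hc' hs.1))))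
  refine ⟨K, fun v hv => ?_⟩
  have h := (convex_Icc (min c 1) (max C 1)).norm_image_sub_le_of_norm_hasDerivWithin_le
    (f := fun v : ℝ => v ^ p) (x := 1) (y := v)
    (fun x hx => (Real.hasDerivAt_rpow_const (p := p)
      (Or.inl (ne_of_gt (lt_of_lt_of_le hc' hx.1)))).hasDerivWithinAt) hK
    ⟨min_le_right _ _, le_max_right _ _⟩
    ⟨(min_le_left _ _).trans hv.1, hv.2.trans (le_max_left _ _)⟩
  rw [Real.one_rpow, Real.norm_eq_abs, Real.norm_eq_abs] at h
  rwa [abs_sub_comm]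

lemma KParams.one_le_m (P : KParams) : 1 ≤ P.m := by
  have : (2:ℝ) ≤ P.d := by exact_mod_cast P.hd
  unfold KParams.m; linarith

namespace SolK

variable {P : KParams} {T : ℝ} {v₀ u₀ : ℝ → ℝ} (S : SolK P T v₀ u₀)

/-- The flux `r^m u` of the mass equation. -/
def massFlux (t x : ℝ) : ℝ := S.r t x ^ P.m * S.u t x

/-- The capillary flux `r^(2m) v^(-(β+5)) v_x`. -/
def capFlux (t x : ℝ) : ℝ := S.r t x ^ (2 * P.m) * S.v t x ^ (-(P.β + 5)) * S.vx t x

/-- The viscous stress. -/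
def viscStress (t x : ℝ) : ℝ := (2 * P.mu + P.lam * S.v t x ^ (-P.α)) * S.vt t x / S.v t x

/-- The quadratic part of the Korteweg stress. -/
def kortStress (t x : ℝ) : ℝ :=
  (P.β + 5) / 2 * S.r t x ^ (2 * P.m) * S.v t x ^ (-(P.β + 6)) * S.vx t x ^ 2

/-- The relative pressure `1 - v^(-γ)`. -/
def relPressure (t x : ℝ) : ℝ := 1 - S.v t x ^ (-P.γ)

/-- The energy density. -/
def energy (t x : ℝ) : ℝ :=
  Phi P.γ (S.v t x) + S.u t x ^ 2 / 2
    + S.r t x ^ (2 * P.m) * S.vx t x ^ 2 / (2 * S.v t x ^ (P.β + 5))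

/-- The time derivative of the energy density. -/
def energyRate (t x : ℝ) : ℝ :=
  S.relPressure t x * S.vt t x + S.u t x * S.ut t x
    + P.m * S.r t x ^ (2 * P.m - 1) * S.u t x * S.v t x ^ (-(P.β + 5)) * S.vx t x ^ 2
    + S.capFlux t x * S.vtx t x - S.kortStress t x * S.vt t x

/-- The part of the spatial energy flux multiplying the first derivative of a cutoff, after the
second derivatives of `v` have been removed by an integration by parts. -/
def energyFlux (t x : ℝ) : ℝ :=
  S.massFlux t x * (S.relPressure t x + S.viscStress t x - S.kortStress t x)
    + 2 * S.vt t x * S.capFlux t x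

/-- The dissipation density. -/
def dissipation (t x : ℝ) : ℝ :=
  (2 * P.mu + P.lam * S.v t x ^ (-P.α)) * S.vt t x ^ 2 / S.v t x

lemma dissipation_eq (t x : ℝ) : S.dissipation t x = S.viscStress t x * S.vt t x := by
  unfold dissipation viscStress; ring

variable {S} in
lemma r_pos {t x : ℝ} (ht : t ∈ Icc (0:ℝ) T) (hx : x ∈ Ici (0:ℝ)) : 0 < S.r t x :=
  lt_of_lt_of_le P.ha (S.r_ge t ht x hx)

lemma r_rpow_eq {t x : ℝ} (ht : t ∈ Icc (0:ℝ) T) (hx : x ∈ Ici (0:ℝ)) :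
    S.r t x ^ (P.m + 1) = P.a ^ (P.m + 1) + (P.m + 1) * ∫ y in (0:ℝ)..x, S.v t y := by
  have hm := P.one_le_m
  have h : ∫ y in (0:ℝ)..x, (P.m + 1) * S.v t y = S.r t x ^ (P.m + 1) - S.r t 0 ^ (P.m + 1) := by
    refine intervalIntegral.integral_eq_sub_of_hasDerivAt
      (f := fun y => S.r t y ^ (P.m + 1)) (f' := fun y => (P.m + 1) * S.v t y) (fun y hy => ?_)
      (intervalIntegrable_of_continuousOn_Ici
        (continuousOn_const.mul (continuousOn_slice S.cont_v ht)) hx)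
    rw [uIcc_of_le hx] at hy
    have hr := r_pos (S := S) ht hy.1
    refine ((S.r_x t ht y hy.1).rpow_const (p := P.m + 1) (Or.inl hr.ne')).congr_deriv ?_
    rw [Real.rpow_neg hr.le, add_sub_cancel_right]
    have := Real.rpow_pos_of_pos hr P.m
    field_simp
  rw [intervalIntegral.integral_const_mul, S.r_bd t ht] at h
  linarith

lemma cont_r (hT : 0 ≤ T) :
    ContinuousOn (fun p : ℝ × ℝ => S.r p.1 p.2) (Icc (0:ℝ) T ×ˢ Ici (0:ℝ)) := by
  have hm := P.one_le_m
  have h1 : ContinuousOn (fun p : ℝ × ℝ => S.r p.1 p.2 ^ (P.m + 1)) (Icc (0:ℝ) T ×ˢ Ici (0:ℝ)) :=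
    (continuousOn_const.add (continuousOn_const.mul (continuousOn_primitive hT S.cont_v))).congr
      fun p hp => S.r_rpow_eq hp.1 hp.2
  refine (h1.rpow_const (p := (P.m + 1)⁻¹) fun p hp => Or.inr (by positivity)).congr
    fun p hp => ?_
  simp only
  rw [← Real.rpow_mul (r_pos (S := S) hp.1 hp.2).le, mul_inv_cancel₀ (by linarith),
    Real.rpow_one]

lemma cont_r_rpow (hT : 0 ≤ T) (p : ℝ) :
    ContinuousOn (fun z : ℝ × ℝ => S.r z.1 z.2 ^ p) (Icc (0:ℝ) T ×ˢ Ici (0:ℝ)) :=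
  (S.cont_r hT).rpow_const fun _ hz => Or.inl (r_pos hz.1 hz.2).ne'

lemma cont_v_rpow (p : ℝ) :
    ContinuousOn (fun z : ℝ × ℝ => S.v z.1 z.2 ^ p) (Icc (0:ℝ) T ×ˢ Ici (0:ℝ)) :=
  S.cont_v.rpow_const fun z hz => Or.inl (S.v_pos z.1 hz.1 z.2 hz.2).ne'

lemma cont_massFlux (hT : 0 ≤ T) :
    ContinuousOn (fun p : ℝ × ℝ => S.massFlux p.1 p.2) (Icc (0:ℝ) T ×ˢ Ici (0:ℝ)) :=
  (S.cont_r_rpow hT _).mul S.cont_u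

lemma cont_capFlux (hT : 0 ≤ T) :
    ContinuousOn (fun p : ℝ × ℝ => S.capFlux p.1 p.2) (Icc (0:ℝ) T ×ˢ Ici (0:ℝ)) :=
  ((S.cont_r_rpow hT _).mul (S.cont_v_rpow _)).mul S.cont_vx

lemma cont_viscStress :
    ContinuousOn (fun p : ℝ × ℝ => S.viscStress p.1 p.2) (Icc (0:ℝ) T ×ˢ Ici (0:ℝ)) :=
  ((continuousOn_const.add (continuousOn_const.mul (S.cont_v_rpow _))).mul S.cont_vt).div S.cont_v
    fun z hz => (S.v_pos z.1 hz.1 z.2 hz.2).ne'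

lemma cont_kortStress (hT : 0 ≤ T) :
    ContinuousOn (fun p : ℝ × ℝ => S.kortStress p.1 p.2) (Icc (0:ℝ) T ×ˢ Ici (0:ℝ)) :=
  ((continuousOn_const.mul (S.cont_r_rpow hT _)).mul (S.cont_v_rpow _)).mul (S.cont_vx.pow 2)

lemma cont_relPressure :
    ContinuousOn (fun p : ℝ × ℝ => S.relPressure p.1 p.2) (Icc (0:ℝ) T ×ˢ Ici (0:ℝ)) :=
  continuousOn_const.sub (S.cont_v_rpow _)

lemma cont_dissipation :
    ContinuousOn (fun p : ℝ × ℝ => S.dissipation p.1 p.2) (Icc (0:ℝ) T ×ˢ Ici (0:ℝ)) :=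
  (S.cont_viscStress.mul S.cont_vt).congr fun z _ => S.dissipation_eq z.1 z.2

lemma cont_energyFlux (hT : 0 ≤ T) :
    ContinuousOn (fun p : ℝ × ℝ => S.energyFlux p.1 p.2) (Icc (0:ℝ) T ×ˢ Ici (0:ℝ)) :=
  ((S.cont_massFlux hT).mul ((S.cont_relPressure.add S.cont_viscStress).sub
    (S.cont_kortStress hT))).add ((continuousOn_const.mul S.cont_vt).mul (S.cont_capFlux hT))

lemma cont_energy (hT : 0 ≤ T) :
    ContinuousOn (fun p : ℝ × ℝ => S.energy p.1 p.2) (Icc (0:ℝ) T ×ˢ Ici (0:ℝ)) := by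
  refine (ContinuousOn.add ?_ ((S.cont_u.pow 2).div_const 2)).add
    (((S.cont_r_rpow hT _).mul (S.cont_vx.pow 2)).div
      (continuousOn_const.mul (S.cont_v_rpow _)) fun z hz => ?_)
  · exact ContinuousOn.comp (g := Phi P.γ) (t := Ioi 0)
      (fun v hv => (hasDerivAt_Phi P.γ hv).continuousAt.continuousWithinAt) S.cont_v
      fun z hz => S.v_pos z.1 hz.1 z.2 hz.2
  · have := Real.rpow_pos_of_pos (S.v_pos z.1 hz.1 z.2 hz.2) (P.β + 5)
    positivity

lemma cont_energyRate (hT : 0 ≤ T) :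
    ContinuousOn (fun p : ℝ × ℝ => S.energyRate p.1 p.2) (Icc (0:ℝ) T ×ˢ Ici (0:ℝ)) :=
  ((((S.cont_relPressure.mul S.cont_vt).add (S.cont_u.mul S.cont_ut)).add
    ((((continuousOn_const.mul (S.cont_r_rpow hT _)).mul S.cont_u).mul (S.cont_v_rpow _)).mul
      (S.cont_vx.pow 2))).add ((S.cont_capFlux hT).mul S.cont_vtx)).sub
    ((S.cont_kortStress hT).mul S.cont_vt)

lemma hasDerivAt_energy {t x : ℝ} (ht : t ∈ Icc (0:ℝ) T) (hx : x ∈ Ici (0:ℝ)) :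
    HasDerivAt (fun τ => S.energy τ x) (S.energyRate t x) t := by
  have hv := S.v_pos t ht x hx
  have hr := r_pos (S := S) ht hx
  have dv := S.hvt t ht x hx
  have h1 := (hasDerivAt_Phi P.γ hv).comp t dv
  have h2 := ((S.hut t ht x hx).pow 2).div_const 2
  have h3 := (((S.r_t t ht x hx).rpow_const (p := 2 * P.m) (Or.inl hr.ne')).mul
    ((S.hvtx t ht x hx).pow 2)).div ((dv.rpow_const (p := P.β + 5) (Or.inl hv.ne')).const_mul 2)
    (by have := Real.rpow_pos_of_pos hv (P.β + 5); positivity)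
  refine ((h1.add h2).add h3).congr_deriv ?_
  have e1 : S.v t x ^ (P.β + 5 - 1) = S.v t x ^ (P.β + 5) / S.v t x := by
    rw [Real.rpow_sub hv, Real.rpow_one]
  have e2 : S.v t x ^ (-(P.β + 6)) = (S.v t x ^ (P.β + 5))⁻¹ / S.v t x := by
    rw [← Real.rpow_neg hv.le, ← Real.rpow_sub_one hv.ne']; congr 1; ring
  have := Real.rpow_pos_of_pos hv (P.β + 5)
  simp only [energyRate, relPressure, capFlux, kortStress]
  rw [e1, e2, Real.rpow_neg hv.le (P.β + 5)]
  simp only [Nat.cast_ofNat, Pi.mul_apply, Pi.pow_apply]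
  field_simp
  ring

lemma hasDerivAt_cutoff_flux {t x : ℝ} (ht : t ∈ Ioo (0:ℝ) T) (hx : 0 < x)
    {χ χ' : ℝ → ℝ} {χ'' : ℝ} (h1 : HasDerivAt χ (χ' x) x) (h2 : HasDerivAt χ' χ'' x) :
    HasDerivAt (fun y => χ y * (S.massFlux t y * (S.relPressure t y
        + (S.viscStress t y - S.Wx t y - S.kortStress t y)) + S.vt t y * S.capFlux t y)
        + χ' y * (S.massFlux t y * S.capFlux t y))
      (χ x * (S.energyRate t x + S.dissipation t x) + χ' x * S.energyFlux t x
        + χ'' * (S.massFlux t x * S.capFlux t x)) x := by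
  have ht' := Ioo_subset_Icc_self ht
  have hx' : x ∈ Ici (0:ℝ) := hx.le
  have hv := S.v_pos t ht' x hx'
  have hr := r_pos (S := S) ht' hx'
  have dw : HasDerivAt (S.massFlux t) (S.vt t x) x := S.mass t ht' x hx'
  have dW : HasDerivAt (S.capFlux t) (S.Wx t x) x := S.hWx t ht' x hx'
  have dQ : HasDerivAt (fun y => S.viscStress t y - S.Wx t y - S.kortStress t y) (S.Qx t x) x :=
    S.hQx t ht' x hx'
  have dp : HasDerivAt (S.relPressure t) (-(S.vx t x * -P.γ * S.v t x ^ (-P.γ - 1))) x :=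
    ((S.hvx t ht' x hx').rpow_const (Or.inl hv.ne')).const_sub 1
  have dvt : HasDerivAt (S.vt t) (S.vtx t x) x :=
    hasDerivAt_mixed S.cont_vx S.cont_vtx S.hvt S.hvx S.hvtx ht hx
  refine ((h1.mul ((dw.mul (dp.add dQ)).add (dvt.mul dW))).add (h2.mul (dw.mul dW))).congr_deriv ?_
  have hmom := S.momentum t ht' x hx'
  have key : S.u t x * S.ut t x + P.m * S.r t x ^ (2 * P.m - 1) * S.u t x
      * S.v t x ^ (-(P.β + 5)) * S.vx t x ^ 2
      = S.massFlux t x * (S.Qx t x + P.γ * S.v t x ^ (-P.γ - 1) * S.vx t x) := by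
    unfold massFlux
    linear_combination S.u t x * hmom
  simp only [energyRate, energyFlux, dissipation_eq, Pi.add_apply, Pi.mul_apply]
  linear_combination -χ x * key

lemma massFlux_zero {t : ℝ} (ht : t ∈ Icc (0:ℝ) T) : S.massFlux t 0 = 0 := by
  simp [massFlux, S.bd_u t ht]

lemma capFlux_zero {t : ℝ} (ht : t ∈ Icc (0:ℝ) T) : S.capFlux t 0 = 0 := by
  simp [capFlux, S.bd_vx t ht]

lemma integral_cutoff_energyRate {t R : ℝ} (ht : t ∈ Ioo (0:ℝ) T) (hR : 0 ≤ R)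
    {χ χ' χ'' : ℝ → ℝ} (h1 : ∀ x, HasDerivAt χ (χ' x) x) (h2 : ∀ x, HasDerivAt χ' (χ'' x) x)
    (h3 : Continuous χ'') (hχR : χ R = 0) (hχ'R : χ' R = 0) :
    ∫ x in (0:ℝ)..R, χ x * S.energyRate t x
      = -(∫ x in (0:ℝ)..R, χ x * S.dissipation t x)
        - ∫ x in (0:ℝ)..R, (χ' x * S.energyFlux t x
          + χ'' x * (S.massFlux t x * S.capFlux t x)) := by
  have hT : 0 ≤ T := (ht.1.trans ht.2).le
  have ht' := Ioo_subset_Icc_self ht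
  have c1 : Continuous χ := continuous_iff_continuousAt.2 fun x => (h1 x).continuousAt
  have c2 : Continuous χ' := continuous_iff_continuousAt.2 fun x => (h2 x).continuousAt
  have cr : ContinuousOn (fun x => χ x * S.energyRate t x) (Ici 0) :=
    c1.continuousOn.mul (continuousOn_slice (S.cont_energyRate hT) ht')
  have cd : ContinuousOn (fun x => χ x * S.dissipation t x) (Ici 0) :=
    c1.continuousOn.mul (continuousOn_slice S.cont_dissipation ht')
  have cf : ContinuousOn (fun x => χ' x * S.energyFlux t x
      + χ'' x * (S.massFlux t x * S.capFlux t x)) (Ici 0) :=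
    (c2.continuousOn.mul (continuousOn_slice (S.cont_energyFlux hT) ht')).add
      (h3.continuousOn.mul ((continuousOn_slice (S.cont_massFlux hT) ht').mul
        (continuousOn_slice (S.cont_capFlux hT) ht')))
  have cw := continuousOn_slice (S.cont_massFlux hT) ht'
  have cW := continuousOn_slice (S.cont_capFlux hT) ht'
  have cQ : ContinuousOn (fun y => S.viscStress t y - S.Wx t y - S.kortStress t y) (Ici 0) :=
    fun y hy => (S.hQx t ht' y hy).continuousAt.continuousWithinAt
  have cΨ := (c1.continuousOn.mul ((cw.mul ((continuousOn_slice S.cont_relPressure ht').add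
    cQ)).add ((continuousOn_slice S.cont_vt ht').mul cW))).add (c2.continuousOn.mul (cw.mul cW))
  have key := intervalIntegral.integral_eq_sub_of_hasDerivAt_of_le hR
    (cΨ.mono Icc_subset_Ici_self)
    (fun x hx => S.hasDerivAt_cutoff_flux ht hx.1 (h1 x) (h2 x))
    (intervalIntegrable_of_continuousOn_Ici (((cr.add cd).add cf).congr
      fun x _ => by simp only [Pi.add_apply]; ring) hR)
  simp only [Pi.add_apply, Pi.mul_apply, hχR, hχ'R, S.massFlux_zero ht', S.capFlux_zero ht'] at key
  rw [intervalIntegral.integral_congr (g := fun x => (χ x * S.energyRate t x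
    + χ x * S.dissipation t x) + (χ' x * S.energyFlux t x
      + χ'' x * (S.massFlux t x * S.capFlux t x))) (fun x _ => by ring),
    intervalIntegral.integral_add
      ((intervalIntegrable_of_continuousOn_Ici cr hR).add
        (intervalIntegrable_of_continuousOn_Ici cd hR))
      (intervalIntegrable_of_continuousOn_Ici cf hR),
    intervalIntegral.integral_add (intervalIntegrable_of_continuousOn_Ici cr hR)
      (intervalIntegrable_of_continuousOn_Ici cd hR)] at key
  linarith

end SolK

lemma pow_pred_mul_le {n θ : ℝ} (hn : 0 ≤ n) (hθ : 0 ≤ θ) (k : ℕ) :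
    θ ^ k * n ^ (k + 1) ≤ n * (n ^ (k + 1) * θ ^ (k + 1) + 1) := by
  have hz : 0 ≤ n * θ := by positivity
  have h : (n * θ) ^ k ≤ (n * θ) ^ (k + 1) + 1 := by
    rcases le_total (n * θ) 1 with h1 | h1
    · linarith [pow_le_one₀ hz h1 (n := k), pow_nonneg hz (k + 1)]
    · exact (pow_le_pow_right₀ h1 k.le_succ).trans (le_add_of_nonneg_right zero_le_one)
  calc θ ^ k * n ^ (k + 1) = n * (n * θ) ^ k := by ring
    _ ≤ n * ((n * θ) ^ (k + 1) + 1) := by gcongr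
    _ = _ := by ring

/-- Young's inequality for the terms of the cutoff error that are quadratic in the solution. -/
lemma quadratic_error_le {k δ ε K t s a b p G : ℝ} (hk : 0 ≤ k) (hδ : 0 ≤ δ) (hδε : δ ≤ ε)
    (ht : 0 ≤ t) (hts : t ≤ s) (ha : 0 ≤ a) (hp : 0 ≤ p) (hK : 0 ≤ K)
    (hpb : p ≤ K * b) (hG : k * ε * K ≤ G) :
    k * δ * (t * a * p) ≤ G * (((s * a) ^ 2 + b ^ 2) / 2) := by
  have hε := hδ.trans hδε
  have hs := ht.trans hts
  calc k * δ * (t * a * p) ≤ k * ε * (s * a * (K * b)) := by gcongr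
    _ = k * ε * K * (s * a * b) := by ring
    _ ≤ k * ε * K * (((s * a) ^ 2 + b ^ 2) / 2) := by
      gcongr
      linarith [two_mul_le_add_sq (s * a) b]
    _ ≤ G * (((s * a) ^ 2 + b ^ 2) / 2) := by gcongr

/-- Absorption of the cubic weight: a power of the cutoff is traded against its length scale. -/
lemma cubic_weight_le {K n θ q z : ℝ} {e : ℕ} (he : 1 ≤ e) (hn : 1 ≤ n) (hθ : 0 ≤ θ)
    (hq : 0 ≤ q) (hqK : q ≤ K * n ^ (2 * e)) :
    θ ^ (4 * e - 1) * (q * z) ^ 2 ≤ n * (θ ^ (4 * e) * (q * z) ^ 2 + K ^ 2 * z ^ 2) := by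
  have hn0 : 0 < n := by linarith
  have h1 := pow_pred_mul_le hn0.le hθ (4 * e - 1)
  rw [show 4 * e - 1 + 1 = 4 * e by omega] at h1
  have h2 : (q * z) ^ 2 ≤ K ^ 2 * n ^ (4 * e) * z ^ 2 := by
    calc (q * z) ^ 2 = q ^ 2 * z ^ 2 := by ring
      _ ≤ (K * n ^ (2 * e)) ^ 2 * z ^ 2 := by gcongr
      _ = _ := by ring
  have hp : 0 < n ^ (4 * e) := by positivity
  refine le_of_mul_le_mul_left (a := n ^ (4 * e)) ?_ hp
  calc _ = (θ ^ (4 * e - 1) * n ^ (4 * e)) * (q * z) ^ 2 := by ring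
    _ ≤ n * (n ^ (4 * e) * θ ^ (4 * e) + 1) * (q * z) ^ 2 :=
      mul_le_mul_of_nonneg_right h1 (sq_nonneg _)
    _ = n * (n ^ (4 * e) * (θ ^ (4 * e) * (q * z) ^ 2)) + n * (q * z) ^ 2 := by ring
    _ ≤ n * (n ^ (4 * e) * (θ ^ (4 * e) * (q * z) ^ 2)) + n * (K ^ 2 * n ^ (4 * e) * z ^ 2) := by
      gcongr
    _ = _ := by ring

lemma abs_error_le_sum {c₁ c₂ q u p D b₅ b₆ y w : ℝ} (hc1 : 0 ≤ c₁) (hc2 : 0 ≤ c₂)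
    (hq : 0 ≤ q) :
    |-c₁ * (q * u * (p + D - b₆ * w ^ 2) + 2 * y * (b₅ * q * w)) + c₂ * (q * u * (b₅ * q * w))|
      ≤ c₁ * (q * |u| * |p|) + c₁ * (q * |u| * |D|) + c₁ * (q * |u| * (|b₆| * w ^ 2))
        + c₁ * (2 * |y| * (|b₅| * q * |w|)) + c₂ * (|q * u| * (|b₅| * q * |w|)) := by
  have e1 : |c₁ * (q * u * p)| = c₁ * (q * |u| * |p|) := by
    rw [abs_mul, abs_mul, abs_mul, abs_of_nonneg hc1, abs_of_nonneg hq]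
  have e2 : |c₁ * (q * u * D)| = c₁ * (q * |u| * |D|) := by
    rw [abs_mul, abs_mul, abs_mul, abs_of_nonneg hc1, abs_of_nonneg hq]
  have e3 : |c₁ * (q * u * (b₆ * w ^ 2))| = c₁ * (q * |u| * (|b₆| * w ^ 2)) := by
    rw [abs_mul, abs_mul, abs_mul, abs_mul, abs_of_nonneg hc1, abs_of_nonneg hq,
      abs_of_nonneg (sq_nonneg w)]
  have e4 : |c₁ * (2 * y * (b₅ * q * w))| = c₁ * (2 * |y| * (|b₅| * q * |w|)) := by
    rw [abs_mul, abs_mul, abs_mul, abs_mul, abs_mul b₅ q, abs_of_nonneg hc1, abs_of_nonneg hq,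
      abs_two]
  have e5 : |c₂ * (q * u * (b₅ * q * w))| = c₂ * (|q * u| * (|b₅| * q * |w|)) := by
    rw [abs_mul, abs_mul (q * u), abs_mul (b₅ * q), abs_mul b₅ q, abs_of_nonneg hc2,
      abs_of_nonneg hq]
  rw [← e1, ← e2, ← e3, ← e4, ← e5]
  have : -c₁ * (q * u * (p + D - b₆ * w ^ 2) + 2 * y * (b₅ * q * w))
      + c₂ * (q * u * (b₅ * q * w)) = -(c₁ * (q * u * p)) + -(c₁ * (q * u * D))
      + c₁ * (q * u * (b₆ * w ^ 2)) + -(c₁ * (2 * y * (b₅ * q * w)))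
      + c₂ * (q * u * (b₅ * q * w)) := by ring
  rw [this]
  refine (abs_add_le _ _).trans (add_le_add ((abs_add_le _ _).trans (add_le_add
    ((abs_add_le _ _).trans (add_le_add ((abs_add_le _ _).trans ?_) le_rfl)) ?_)) le_rfl)
  · rw [abs_neg, abs_neg]
  · rw [abs_neg]

set_option maxHeartbeats 1000000 in
/-- Pointwise bound of the cutoff error terms in the localized energy balance, with cutoff
`θ ^ (4 * e)`, `θ = 1 - x / R`, on an interval of length `R = n ^ (2 (e + 1))`. -/
lemma abs_cutoff_error_le {K n R θ N q u ν z y p D b₅ b₆ : ℝ} {e : ℕ} (he : 1 ≤ e) (hK : 1 ≤ K)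
    (hn : 1 ≤ n) (hR : R = n ^ (2 * (e + 1))) (hθ : 0 ≤ θ) (hθ1 : θ ≤ 1) (hN : 0 ≤ N)
    (hq : 0 ≤ q) (hqK : q ≤ K * n ^ (2 * e)) (hw : (q * u) ^ 2 ≤ R * N) (hu : u ^ 2 ≤ K * N)
    (hp : |p| ≤ K * |ν|) (hD : |D| ≤ K * |y|) (hb₅ : |b₅| ≤ K) (hb₆ : |b₆| ≤ K) :
    |-((4 * e : ℕ) / R * θ ^ (4 * e - 1))
          * (q * u * (p + D - b₆ * (q * z) ^ 2) + 2 * y * (b₅ * q * (q * z)))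
        + (4 * e : ℕ) * (4 * e - 1 : ℕ) / R ^ 2 * θ ^ (4 * e - 2) * (q * u * (b₅ * q * (q * z)))|
      ≤ 3 * (4 * e : ℕ) ^ 2 * K ^ 6 / n
          * ((1 + N) * (θ ^ (4 * e) * (u ^ 2 + (q * z) ^ 2) + ν ^ 2 + z ^ 2) + y ^ 2 + N / R) := by
  have hn0 : 0 < n := by linarith
  have hK0 : 0 ≤ K := by linarith
  have hR0 : 0 < R := by rw [hR]; positivity
  have hcub := cubic_weight_le (z := z) he hn hθ hq hqK
  have hδ : q / R ≤ K / n ^ 2 := by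
    rw [div_le_div_iff₀ hR0 (by positivity), hR]
    calc q * n ^ 2 ≤ K * n ^ (2 * e) * n ^ 2 := by gcongr
      _ = _ := by ring
  have hδ' : q / R ≤ K / n := hδ.trans (div_le_div_of_nonneg_left hK0 hn0 (by nlinarith))
  have hδ0 : 0 ≤ q / R := by positivity
  have hu' : |u| ≤ K * (1 + N) := by
    apply abs_le_of_sq_le_sq _ (by positivity)
    calc u ^ 2 ≤ K * N := hu
      _ ≤ K ^ 2 * (1 + N) ^ 2 := by
        gcongr
        · nlinarith
        · nlinarith
      _ = (K * (1 + N)) ^ 2 := by ring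
  have hωR : (|q * u| / R) ^ 2 ≤ N / R := by
    rw [div_pow, sq_abs, div_le_div_iff₀ (by positivity) hR0]
    nlinarith
  have hω0 : 0 ≤ |q * u| / R := by positivity
  have ht0 : 0 ≤ θ ^ (4 * e - 1) := by positivity
  have ht0' : 0 ≤ θ ^ (4 * e - 2) := by positivity
  have hts : θ ^ (4 * e - 1) ≤ θ ^ (2 * e) := pow_le_pow_of_le_one hθ hθ1 (by omega)
  have hts' : θ ^ (4 * e - 2) ≤ θ ^ (2 * e) := pow_le_pow_of_le_one hθ hθ1 (by omega)
  have hs2 : θ ^ (4 * e) = (θ ^ (2 * e)) ^ 2 := by ring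
  have hk1 : (1:ℝ) ≤ (4 * e : ℕ) := by exact_mod_cast (by omega : 1 ≤ 4 * e)
  have hkm : ((4 * e - 1 : ℕ) : ℝ) ≤ (4 * e : ℕ) := by exact_mod_cast Nat.sub_le _ _
  have hkm0 : (0:ℝ) ≤ (4 * e - 1 : ℕ) := Nat.cast_nonneg _
  rw [hs2] at hcub ⊢
  have hz2 : (q * z) ^ 2 = |q * z| ^ 2 := (sq_abs _).symm
  have hy2 := sq_abs y
  have hu2 := sq_abs u
  have hν2 := sq_abs ν
  have hsum := abs_error_le_sum (c₁ := (4 * e : ℕ) / R * θ ^ (4 * e - 1))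
    (c₂ := (4 * e : ℕ) * (4 * e - 1 : ℕ) / R ^ 2 * θ ^ (4 * e - 2)) (q := q) (u := u) (p := p)
    (D := D) (b₅ := b₅) (b₆ := b₆) (y := y) (w := q * z) (by positivity) (by positivity) hq
  refine hsum.trans ?_
  clear hsum
  rw [show (4 * e : ℕ) / R * θ ^ (4 * e - 1) * (q * |u| * |p|)
      = (4 * e : ℕ) * (q / R) * (θ ^ (4 * e - 1) * |u| * |p|) by ring,
    show (4 * e : ℕ) / R * θ ^ (4 * e - 1) * (q * |u| * |D|)
      = (4 * e : ℕ) * (q / R) * (θ ^ (4 * e - 1) * |u| * |D|) by ring,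
    show (4 * e : ℕ) / R * θ ^ (4 * e - 1) * (q * |u| * (|b₆| * (q * z) ^ 2))
      = (4 * e : ℕ) * (q / R) * |u| * |b₆| * (θ ^ (4 * e - 1) * (q * z) ^ 2) by ring,
    show (4 * e : ℕ) / R * θ ^ (4 * e - 1) * (2 * |y| * (|b₅| * q * |q * z|))
      = 2 * ((4 * e : ℕ) * (q / R) * (θ ^ (4 * e - 1) * |q * z| * (|b₅| * |y|))) by ring,
    show (4 * e : ℕ) * (4 * e - 1 : ℕ) / R ^ 2 * θ ^ (4 * e - 2)
        * (|q * u| * (|b₅| * q * |q * z|))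
      = (4 * e : ℕ) * (4 * e - 1 : ℕ) * (q / R)
        * (θ ^ (4 * e - 2) * |q * z| * (|b₅| * (|q * u| / R))) by ring]
  generalize q / R = δ at *
  generalize |q * u| / R = ω at *
  generalize θ ^ (4 * e - 1) = t at *
  generalize θ ^ (4 * e - 2) = t' at *
  generalize θ ^ (2 * e) = s at *
  generalize ((4 * e : ℕ) : ℝ) = k at *
  generalize ((4 * e - 1 : ℕ) : ℝ) = k' at *
  rw [hz2] at hcub ⊢
  have hA0 := abs_nonneg (q * z)
  have hu0 := abs_nonneg u
  have hs0 := ht0.trans hts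
  rw [← hy2, ← hu2, ← hν2]
  generalize |q * z| = A at *
  have hNR : 0 ≤ N / R := by positivity
  generalize N / R = M at *
  have hkk : k ≤ k ^ 2 := by nlinarith
  have hK6 : K ^ 2 ≤ K ^ 6 := pow_le_pow_right₀ hK (by norm_num)
  have hK5 : K ^ 5 ≤ K ^ 6 := pow_le_pow_right₀ hK (by norm_num)
  have hK2 : 1 ≤ K ^ 2 := one_le_pow₀ hK
  have hk0 : 0 ≤ k := by linarith
  have hG1 : k * (K / n) * K ≤ k ^ 2 * K ^ 6 / n := by
    calc k * (K / n) * K = k * K ^ 2 / n := by ring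
      _ ≤ k ^ 2 * K ^ 6 / n := by gcongr
  have hG2 : k * k' * (K / n) * K ≤ k ^ 2 * K ^ 6 / n := by
    calc k * k' * (K / n) * K = k * k' * K ^ 2 / n := by ring
      _ ≤ k * k * K ^ 6 / n := by gcongr
      _ = _ := by ring
  have hG0 : 0 ≤ k ^ 2 * K ^ 6 / n := by positivity
  have t1 := quadratic_error_le hk0 hδ0 hδ' ht0 hts hu0 (abs_nonneg p) hK0 hp hG1
  have t2 := quadratic_error_le hk0 hδ0 hδ' ht0 hts hu0 (abs_nonneg D) hK0 hD hG1
  have t4 := quadratic_error_le hk0 hδ0 hδ' ht0 hts hA0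
    (mul_nonneg (abs_nonneg b₅) (abs_nonneg y)) hK0
    (mul_le_mul_of_nonneg_right hb₅ (abs_nonneg y)) hG1
  have t5 := quadratic_error_le (mul_nonneg hk0 hkm0) hδ0 hδ' ht0' hts' hA0
    (mul_nonneg (abs_nonneg b₅) hω0) hK0 (mul_le_mul_of_nonneg_right hb₅ hω0) hG2
  have t3 : k * δ * |u| * |b₆| * (t * A ^ 2)
      ≤ k ^ 2 * K ^ 6 / n * ((1 + N) * ((s * A) ^ 2 + z ^ 2)) := by
    calc k * δ * |u| * |b₆| * (t * A ^ 2)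
        ≤ k * (K / n ^ 2) * (K * (1 + N)) * K * (n * (s ^ 2 * A ^ 2 + K ^ 2 * z ^ 2)) := by gcongr
      _ ≤ k * (K / n ^ 2) * (K * (1 + N)) * K
            * (n * (K ^ 2 * (s ^ 2 * A ^ 2) + K ^ 2 * z ^ 2)) := by
        have h : s ^ 2 * A ^ 2 ≤ K ^ 2 * (s ^ 2 * A ^ 2) :=
          le_mul_of_one_le_left (by positivity) hK2
        gcongr
      _ = (k * K ^ 5 / n) * ((1 + N) * ((s * A) ^ 2 + z ^ 2)) := by field_simp
      _ ≤ k ^ 2 * K ^ 6 / n * ((1 + N) * ((s * A) ^ 2 + z ^ 2)) := by gcongr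
  generalize |u| = u' at *
  generalize |y| = y' at *
  generalize |ν| = ν' at *
  rw [show 3 * k ^ 2 * K ^ 6 / n = k ^ 2 * K ^ 6 / n * 3 by ring]
  generalize k ^ 2 * K ^ 6 / n = G at *
  have fin : ((s * u') ^ 2 + ν' ^ 2) / 2 + ((s * u') ^ 2 + y' ^ 2) / 2
      + (1 + N) * ((s * A) ^ 2 + z ^ 2) + 2 * (((s * A) ^ 2 + y' ^ 2) / 2)
      + ((s * A) ^ 2 + ω ^ 2) / 2
      ≤ 3 * ((1 + N) * (s ^ 2 * (u' ^ 2 + A ^ 2) + ν' ^ 2 + z ^ 2) + y' ^ 2 + M) := by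
    have x1 := mul_nonneg hN (sq_nonneg (s * u'))
    have x2 := mul_nonneg hN (sq_nonneg (s * A))
    have x3 := mul_nonneg hN (sq_nonneg ν')
    have x4 := mul_nonneg hN (sq_nonneg z)
    have x5 := sq_nonneg (s * u')
    have x6 := sq_nonneg (s * A)
    linarith [sq_nonneg ν', sq_nonneg z, sq_nonneg y']
  refine le_trans ?_ ((mul_le_mul_of_nonneg_left fin hG0).trans_eq (by ring))
  linarith

namespace KParams

/-- The exponent `m = d - 1` as a natural number. -/
def deg (P : KParams) : ℕ := P.d - 1

lemma one_le_deg (P : KParams) : 1 ≤ P.deg := by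
  have := P.hd
  unfold deg; omega

lemma m_eq_deg (P : KParams) : P.m = P.deg := by
  have := P.hd
  rw [m, deg, Nat.cast_sub (by omega), Nat.cast_one]

end KParams

lemma pow_radius_le {A C n r x : ℝ} {e : ℕ} (hA : 0 ≤ A) (hC : 0 ≤ C) (hn : 1 ≤ n) (hr : 0 ≤ r)
    (hx : x ≤ n ^ (2 * (e + 1))) (h : r ^ (e + 1) ≤ A + C * x) :
    r ^ e ≤ (1 + A + C) ^ e * n ^ (2 * e) := by
  have hn1 : 1 ≤ n ^ (2 * (e + 1)) := one_le_pow₀ hn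
  have hB : 1 + A + C ≤ (1 + A + C) ^ (e + 1) := le_self_pow₀ (by linarith) (by omega)
  have h2 : r ^ (e + 1) ≤ ((1 + A + C) * n ^ 2) ^ (e + 1) := by
    calc r ^ (e + 1) ≤ A + C * x := h
      _ ≤ A * n ^ (2 * (e + 1)) + C * n ^ (2 * (e + 1)) := by
        gcongr
        exact le_mul_of_one_le_right hA hn1
      _ ≤ (1 + A + C) * n ^ (2 * (e + 1)) := by linarith
      _ ≤ (1 + A + C) ^ (e + 1) * n ^ (2 * (e + 1)) := by gcongr
      _ = _ := by rw [mul_pow, ← pow_mul]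
  have h3 : r ≤ (1 + A + C) * n ^ 2 := le_of_pow_le_pow_left₀ (by omega) (by positivity) h2
  calc r ^ e ≤ ((1 + A + C) * n ^ 2) ^ e := by gcongr
    _ = _ := by rw [mul_pow, ← pow_mul]

namespace SolK

variable {P : KParams} {T : ℝ} {v₀ u₀ : ℝ → ℝ} (S : SolK P T v₀ u₀)

lemma r_rpow_m (t x : ℝ) : S.r t x ^ P.m = S.r t x ^ P.deg := by
  rw [P.m_eq_deg, Real.rpow_natCast]

lemma r_rpow_two_m (t x : ℝ) : S.r t x ^ (2 * P.m) = (S.r t x ^ P.deg) ^ 2 := by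
  rw [P.m_eq_deg, ← pow_mul, ← Real.rpow_natCast]
  push_cast
  rw [mul_comm]

lemma exists_radius_bound : ∃ K : ℝ, ∀ t ∈ Icc (0:ℝ) T, ∀ x ∈ Ici (0:ℝ),
    x ≤ K * (S.r t x ^ P.deg) ^ 2 ∧
      ∀ n : ℝ, 1 ≤ n → x ≤ n ^ (2 * (P.deg + 1)) → S.r t x ^ P.deg ≤ K * n ^ (2 * P.deg) := by
  obtain ⟨c, C, hc, hcC⟩ := S.v_bdd
  have ha := P.ha
  have he := P.one_le_deg
  obtain ⟨B, hB⟩ : ∃ B, B = P.a ^ (P.deg - 1) * ((P.deg + 1) * c) := ⟨_, rfl⟩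
  have hB0 : 0 < B := by rw [hB]; positivity
  refine ⟨max (1 / B) ((1 + P.a ^ (P.deg + 1) + (P.deg + 1) * |C|) ^ P.deg), fun t ht x hx => ?_⟩
  have hr := r_pos (S := S) ht hx
  have hx0 : 0 ≤ x := hx
  have hcont := continuousOn_slice S.cont_v ht
  have hint := intervalIntegrable_of_continuousOn_Ici hcont hx0
  have hlo : c * x ≤ ∫ y in (0:ℝ)..x, S.v t y := by
    have := intervalIntegral.integral_mono_on hx0 (intervalIntegrable_const (c := c)) hint
      fun y hy => (hcC t ht y hy.1).1
    rw [intervalIntegral.integral_const, smul_eq_mul] at this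
    linarith
  have hhi : ∫ y in (0:ℝ)..x, S.v t y ≤ |C| * x := by
    have := intervalIntegral.integral_mono_on hx0 hint (intervalIntegrable_const (c := |C|))
      fun y hy => (hcC t ht y hy.1).2.trans (le_abs_self C)
    rw [intervalIntegral.integral_const, smul_eq_mul] at this
    linarith
  have heq := S.r_rpow_eq ht hx
  rw [P.m_eq_deg, show (P.deg : ℝ) + 1 = (P.deg + 1 : ℕ) by push_cast; ring, Real.rpow_natCast,
    Real.rpow_natCast] at heq
  push_cast at heq
  have hd : (0:ℝ) ≤ P.deg + 1 := by positivity
  constructor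
  · have h1 : (P.deg + 1) * c * x ≤ S.r t x ^ (P.deg + 1) := by
      rw [heq]
      have := mul_le_mul_of_nonneg_left hlo hd
      have : 0 < P.a ^ (P.deg + 1) := by positivity
      linarith
    have h2 : B * x ≤ (S.r t x ^ P.deg) ^ 2 := by
      calc B * x = P.a ^ (P.deg - 1) * ((P.deg + 1) * c * x) := by rw [hB]; ring
        _ ≤ S.r t x ^ (P.deg - 1) * S.r t x ^ (P.deg + 1) := by
          have := S.r_ge t ht x hx
          gcongr
        _ = (S.r t x ^ P.deg) ^ 2 := by
          rw [← pow_add, ← pow_mul]; congr 1; omega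
    calc x = 1 / B * (B * x) := by field_simp
      _ ≤ 1 / B * (S.r t x ^ P.deg) ^ 2 := by gcongr
      _ ≤ _ := by gcongr; exact le_max_left _ _
  · intro n hn hxn
    refine (pow_radius_le (A := P.a ^ (P.deg + 1)) (C := (P.deg + 1) * |C|) (by positivity)
      (by positivity) hn hr.le hxn ?_).trans ?_
    · rw [heq]
      have := mul_le_mul_of_nonneg_left hhi hd
      linarith
    · gcongr; exact le_max_right _ _

/-- Uniform bounds for a strong solution on the strip. -/
lemma exists_uniform_bound : ∃ K : ℝ, 1 ≤ K ∧ ∀ t ∈ Icc (0:ℝ) T, ∀ x ∈ Ici (0:ℝ),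
    S.v t x ^ (-(P.β + 5)) ≤ K ∧ S.v t x ^ (P.β + 5) ≤ K ∧
      |(P.β + 5) / 2 * S.v t x ^ (-(P.β + 6))| ≤ K ∧ |S.viscStress t x| ≤ K * |S.vt t x| ∧
      |S.relPressure t x| ≤ K * |S.v t x - 1| ∧ x ≤ K * (S.r t x ^ P.deg) ^ 2 ∧
      ∀ n : ℝ, 1 ≤ n → x ≤ n ^ (2 * (P.deg + 1)) → S.r t x ^ P.deg ≤ K * n ^ (2 * P.deg) := by
  obtain ⟨c, C, hc, hcC⟩ := S.v_bdd
  obtain ⟨K₁, h₁⟩ := exists_rpow_le (C := C) hc (-(P.β + 5))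
  obtain ⟨K₂, h₂⟩ := exists_rpow_le (C := C) hc (P.β + 5)
  obtain ⟨K₃, h₃⟩ := exists_rpow_le (C := C) hc (-(P.β + 6))
  obtain ⟨K₄, h₄⟩ := exists_rpow_le (C := C) hc (-P.α)
  obtain ⟨K₅, h₅⟩ := exists_one_sub_rpow_le (C := C) hc (-P.γ)
  obtain ⟨K₆, h₆⟩ := S.exists_radius_bound
  have hfin : ({1, K₁, K₂, |(P.β + 5) / 2| * K₃, (2 * P.mu + P.lam * K₄) / c, K₅, K₆} :
      Set ℝ).Finite := Set.toFinite _
  obtain ⟨K, hK⟩ := hfin.bddAbove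
  simp only [mem_upperBounds, mem_insert_iff, mem_singleton_iff, forall_eq_or_imp,
    forall_eq] at hK
  obtain ⟨k0, k1, k2, k3, k4, k5, k6⟩ := hK
  refine ⟨K, k0, fun t ht x hx => ?_⟩
  have hv : S.v t x ∈ Icc c C := hcC t ht x hx
  have hv0 := S.v_pos t ht x hx
  refine ⟨(h₁ _ hv).trans k1, (h₂ _ hv).trans k2, ?_, ?_, ?_, ?_, fun n hn hxn => ?_⟩
  · rw [abs_mul, abs_of_pos (Real.rpow_pos_of_pos hv0 _)]
    exact (mul_le_mul_of_nonneg_left (h₃ _ hv) (abs_nonneg _)).trans k3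
  · have hp := Real.rpow_pos_of_pos hv0 (-P.α)
    have hmu := P.hmu
    have hlam := P.hlam
    rw [viscStress, abs_div, abs_mul, abs_of_pos hv0, abs_of_pos (by positivity), mul_div_right_comm]
    refine mul_le_mul_of_nonneg_right (le_trans ?_ k4) (abs_nonneg _)
    have h := h₄ _ hv
    have hK₄ : 0 ≤ K₄ := hp.le.trans h
    exact div_le_div₀ (by positivity) (by gcongr) hc hv.1
  · exact (h₅ _ hv).trans (mul_le_mul_of_nonneg_right k5 (abs_nonneg _))
  · exact ((h₆ t ht x hx).1).trans (mul_le_mul_of_nonneg_right k6 (sq_nonneg _))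
  · exact ((h₆ t ht x hx).2 n hn hxn).trans
      (mul_le_mul_of_nonneg_right k6 (by positivity))

lemma massFlux_sq_le {t x : ℝ} (ht : t ∈ Icc (0:ℝ) T) (hx : x ∈ Ici (0:ℝ)) :
    S.massFlux t x ^ 2 ≤ x * ∫ y in Ioi (0:ℝ), S.vt t y ^ 2 := by
  have hc := continuousOn_slice S.cont_vt ht
  have h : ∫ y in (0:ℝ)..x, S.vt t y = S.massFlux t x - S.massFlux t 0 := by
    refine intervalIntegral.integral_eq_sub_of_hasDerivAt (f := S.massFlux t) (fun y hy => ?_)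
      (intervalIntegrable_of_continuousOn_Ici hc hx)
    rw [uIcc_of_le hx] at hy
    exact S.mass t ht y hy.1
  rw [S.massFlux_zero ht, sub_zero] at h
  rw [← h]
  exact (sq_integral_le hc hx).trans
    (mul_le_mul_of_nonneg_left (integral_sq_le_Ioi (S.int_vt t ht) hx) hx)

lemma energy_lower_bound (hγ : 0 ≤ P.γ) {K t x : ℝ} (ht : t ∈ Icc (0:ℝ) T) (hx : x ∈ Ici (0:ℝ))
    (hK : 1 ≤ K) (hv : S.v t x ^ (P.β + 5) ≤ K) :
    S.u t x ^ 2 + (S.r t x ^ P.deg * S.vx t x) ^ 2 ≤ 2 * K * S.energy t x := by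
  have hv0 := S.v_pos t ht x hx
  have hΦ := Phi_nonneg hγ hv0
  have hp := Real.rpow_pos_of_pos hv0 (P.β + 5)
  have hw : (S.r t x ^ P.deg * S.vx t x) ^ 2
      ≤ K * ((S.r t x ^ P.deg * S.vx t x) ^ 2 / S.v t x ^ (P.β + 5)) := by
    rw [← mul_div_assoc, le_div_iff₀ hp, mul_comm K]
    exact mul_le_mul_of_nonneg_left hv (sq_nonneg _)
  rw [energy, r_rpow_two_m, ← mul_pow, mul_comm 2 (S.v t x ^ (P.β + 5)), ← div_div]
  nlinarith [sq_nonneg (S.u t x), mul_nonneg (sub_nonneg.2 hK) (sq_nonneg (S.u t x)),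
    mul_nonneg (zero_le_one.trans hK) hΦ]

lemma energy_nonneg (hγ : 0 ≤ P.γ) {t x : ℝ} (ht : t ∈ Icc (0:ℝ) T) (hx : x ∈ Ici (0:ℝ)) :
    0 ≤ S.energy t x := by
  have hv0 := S.v_pos t ht x hx
  have hΦ := Phi_nonneg hγ hv0
  have hp := Real.rpow_pos_of_pos hv0 (P.β + 5)
  have hr := Real.rpow_pos_of_pos (r_pos (S := S) ht hx) (2 * P.m)
  unfold energy
  positivity

lemma dissipation_nonneg {t x : ℝ} (ht : t ∈ Icc (0:ℝ) T) (hx : x ∈ Ici (0:ℝ)) :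
    0 ≤ S.dissipation t x := by
  have hv0 := S.v_pos t ht x hx
  have hp := Real.rpow_pos_of_pos hv0 (-P.α)
  have hmu := P.hmu
  have hlam := P.hlam
  unfold dissipation
  positivity

end SolK

section Cutoff

variable (k : ℕ) (R : ℝ)

lemma hasDerivAt_cutoff (x : ℝ) : HasDerivAt (fun x : ℝ => (1 - x / R) ^ k)
    (-((k : ℝ) / R * (1 - x / R) ^ (k - 1))) x :=
  ((((hasDerivAt_id x).div_const R).const_sub 1).pow k).congr_deriv (by simp; ring)

lemma hasDerivAt_cutoff_deriv (x : ℝ) :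
    HasDerivAt (fun x : ℝ => -((k : ℝ) / R * (1 - x / R) ^ (k - 1)))
      ((k : ℝ) * (k - 1 : ℕ) / R ^ 2 * (1 - x / R) ^ (k - 2)) x :=
  (((hasDerivAt_cutoff (k - 1) R x).const_mul ((k : ℝ) / R)).neg).congr_deriv (by
    rw [Nat.sub_sub]; ring)

end Cutoff

/-- A Grönwall inequality with an integrable coefficient. -/
lemma one_add_le_exp_integral {Y Y' g : ℝ → ℝ} {T t : ℝ} (hY : ContinuousOn Y (Icc 0 T))
    (hY0 : ∀ s ∈ Icc 0 T, 0 ≤ Y s) (hd : ∀ s ∈ Ioo 0 T, HasDerivAt Y (Y' s) s)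
    (hle : ∀ s ∈ Ioo 0 T, Y' s ≤ g s * (1 + Y s)) (hg : IntervalIntegrable g volume 0 T)
    (hg0 : ∀ s ∈ Icc 0 T, 0 ≤ g s) (ht : t ∈ Icc 0 T) :
    1 + Y t ≤ (1 + Y 0) * Real.exp (∫ s in (0:ℝ)..T, g s) := by
  have hT : 0 ≤ T := ht.1.trans ht.2
  have hp : ∀ s ∈ Icc 0 T, 0 < 1 + Y s := fun s hs => by linarith [hY0 s hs]
  have hsub : Icc 0 t ⊆ Icc 0 T := Icc_subset_Icc_right ht.2
  have hgt : IntegrableOn g (Icc 0 T) := by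
    rwa [intervalIntegrable_iff_integrableOn_Icc_of_le hT] at hg
  have h := intervalIntegral.sub_le_integral_of_hasDeriv_right_of_le (a := 0) (b := t)
    (g := fun s => Real.log (1 + Y s)) (g' := fun s => Y' s / (1 + Y s)) (φ := g) ht.1
    (ContinuousOn.log ((continuousOn_const.add hY).mono hsub) fun s hs => (hp s (hsub hs)).ne')
    (fun s hs => by
      have hs' : s ∈ Ioo 0 T := ⟨hs.1, hs.2.trans_le ht.2⟩
      exact (((hd s hs').const_add 1).log (hp s (Ioo_subset_Icc_self hs')).ne').hasDerivWithinAt)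
    (hgt.mono_set hsub)
    (fun s hs => by
      have hs' : s ∈ Ioo 0 T := ⟨hs.1, hs.2.trans_le ht.2⟩
      exact (div_le_iff₀ (hp s (Ioo_subset_Icc_self hs'))).2 (hle s hs'))
  have h2 : ∫ s in (0:ℝ)..t, g s ≤ ∫ s in (0:ℝ)..T, g s := by
    rw [intervalIntegral.integral_of_le ht.1, intervalIntegral.integral_of_le hT]
    refine setIntegral_mono_set (hgt.mono_set Ioc_subset_Icc_self) ?_
      (Ioc_subset_Ioc_right ht.2).eventuallyLE
    filter_upwards [ae_restrict_mem measurableSet_Ioc] with s hs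
    exact hg0 s (Ioc_subset_Icc_self hs)
  have h3 : Real.log (1 + Y t) ≤ Real.log (1 + Y 0) + ∫ s in (0:ℝ)..T, g s := by linarith
  have h0 := hp 0 (left_mem_Icc.2 hT)
  calc 1 + Y t = Real.exp (Real.log (1 + Y t)) := (Real.exp_log (hp t ht)).symm
    _ ≤ Real.exp (Real.log (1 + Y 0) + ∫ s in (0:ℝ)..T, g s) := Real.exp_le_exp.2 h3
    _ = _ := by rw [Real.exp_add, Real.exp_log h0]

section CutoffIntegral

variable {f : ℝ → ℝ} (k : ℕ)

lemma cutoff_mem_Icc {R x : ℝ} (hR : 0 < R) (hx : x ∈ Icc 0 R) : 1 - x / R ∈ Icc (0:ℝ) 1 :=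
  ⟨sub_nonneg.2 ((div_le_one hR).2 hx.2), sub_le_self _ (div_nonneg hx.1 hR.le)⟩

lemma integral_cutoff_eq_Ioi {R : ℝ} (hR : 0 ≤ R) :
    ∫ x in (0:ℝ)..R, (1 - x / R) ^ k * f x
      = ∫ x in Ioi (0:ℝ), (Ioc 0 R).indicator (fun x => (1 - x / R) ^ k * f x) x := by
  rw [intervalIntegral.integral_of_le hR, setIntegral_indicator measurableSet_Ioc,
    inter_eq_self_of_subset_right Ioc_subset_Ioi_self]

lemma norm_indicator_cutoff_le {R : ℝ} (hR : 0 < R) (x : ℝ) :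
    ‖(Ioc 0 R).indicator (fun x => (1 - x / R) ^ k * f x) x‖ ≤ ‖f x‖ := by
  by_cases hx : x ∈ Ioc 0 R
  · rw [indicator_of_mem hx, norm_mul, norm_pow]
    have h := cutoff_mem_Icc hR (Ioc_subset_Icc_self hx)
    refine mul_le_of_le_one_left (norm_nonneg _) (pow_le_one₀ (norm_nonneg _) ?_)
    rw [Real.norm_of_nonneg h.1]
    exact h.2
  · rw [indicator_of_notMem hx, norm_zero]
    exact norm_nonneg _

lemma norm_integral_cutoff_le (hf : IntegrableOn f (Ioi 0)) {R : ℝ} (hR : 0 < R) :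
    ‖∫ x in (0:ℝ)..R, (1 - x / R) ^ k * f x‖ ≤ ∫ x in Ioi (0:ℝ), ‖f x‖ := by
  rw [integral_cutoff_eq_Ioi k hR.le]
  exact norm_integral_le_of_norm_le hf.norm (ae_of_all _ (norm_indicator_cutoff_le k hR))

lemma tendsto_integral_cutoff (hf : IntegrableOn f (Ioi 0)) {R : ℕ → ℝ} (hR : ∀ i, 0 < R i)
    (hlim : Tendsto R atTop atTop) :
    Tendsto (fun i => ∫ x in (0:ℝ)..R i, (1 - x / R i) ^ k * f x) atTop
      (𝓝 (∫ x in Ioi (0:ℝ), f x)) := by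
  simp only [fun i => integral_cutoff_eq_Ioi (f := f) k (hR i).le]
  refine tendsto_integral_of_dominated_convergence (fun x => ‖f x‖) (fun i => ?_) hf.norm
    (fun i => ae_of_all _ (norm_indicator_cutoff_le k (hR i))) ?_
  · refine AEStronglyMeasurable.indicator (AEStronglyMeasurable.mul ?_ hf.aestronglyMeasurable)
      measurableSet_Ioc
    exact Continuous.aestronglyMeasurable (by fun_prop)
  · filter_upwards [ae_restrict_mem measurableSet_Ioi] with x hx
    have h1 : Tendsto (fun i => (1 - x / R i) ^ k * f x) atTop (𝓝 ((1 - 0) ^ k * f x)) :=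
      ((tendsto_const_nhds.sub (hlim.const_div_atTop x)).pow k).mul_const _
    rw [sub_zero, one_pow, one_mul] at h1
    refine h1.congr' ?_
    filter_upwards [hlim.eventually_ge_atTop x] with i hi
    rw [indicator_of_mem (show x ∈ Ioc 0 (R i) from ⟨hx, hi⟩)]

end CutoffIntegral

namespace SolK

variable {P : KParams} {T : ℝ} {v₀ u₀ : ℝ → ℝ} (S : SolK P T v₀ u₀)

/-- The error made in the energy balance by the cutoff `(1 - x / R) ^ (4 (d - 1))`. -/
def cutoffError (R t : ℝ) : ℝ :=
  ∫ x in (0:ℝ)..R, (-((4 * P.deg : ℕ) / R * (1 - x / R) ^ (4 * P.deg - 1)) * S.energyFlux t x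
    + (4 * P.deg : ℕ) * (4 * P.deg - 1 : ℕ) / R ^ 2 * (1 - x / R) ^ (4 * P.deg - 2)
      * (S.massFlux t x * S.capFlux t x))

/-- The localized quantity controlling the cutoff error. -/
def cutoffDensity (R t x : ℝ) : ℝ :=
  (1 - x / R) ^ (4 * P.deg) * S.energy t x + ((S.v t x - 1) ^ 2 + S.vx t x ^ 2)

lemma cont_cutoffDensity (hT : 0 ≤ T) (R : ℝ) :
    ContinuousOn (fun p : ℝ × ℝ => S.cutoffDensity R p.1 p.2) (Icc (0:ℝ) T ×ˢ Ici (0:ℝ)) :=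
  (ContinuousOn.mul (by fun_prop) (S.cont_energy hT)).add
    (((S.cont_v.sub continuousOn_const).pow 2).add (S.cont_vx.pow 2))

lemma cont_cutoffErrorIntegrand (hT : 0 ≤ T) (R : ℝ) :
    ContinuousOn (fun p : ℝ × ℝ =>
      -((4 * P.deg : ℕ) / R * (1 - p.2 / R) ^ (4 * P.deg - 1)) * S.energyFlux p.1 p.2
      + (4 * P.deg : ℕ) * (4 * P.deg - 1 : ℕ) / R ^ 2 * (1 - p.2 / R) ^ (4 * P.deg - 2)
        * (S.massFlux p.1 p.2 * S.capFlux p.1 p.2)) (Icc (0:ℝ) T ×ˢ Ici (0:ℝ)) :=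
  (ContinuousOn.mul (by fun_prop) (S.cont_energyFlux hT)).add
    (ContinuousOn.mul (by fun_prop) ((S.cont_massFlux hT).mul (S.cont_capFlux hT)))

lemma exists_abs_cutoffError_le (hT : 0 ≤ T) (hγ : 0 ≤ P.γ) :
    ∃ C : ℝ, 0 ≤ C ∧ ∀ n : ℝ, 1 ≤ n → ∀ t ∈ Icc (0:ℝ) T,
      |S.cutoffError (n ^ (2 * (P.deg + 1))) t|
        ≤ C / n * ((1 + ∫ x in Ioi (0:ℝ), S.vt t x ^ 2)
          * (1 + ∫ x in (0:ℝ)..n ^ (2 * (P.deg + 1)),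
            S.cutoffDensity (n ^ (2 * (P.deg + 1))) t x)) := by
  obtain ⟨K, hK, hbd⟩ := S.exists_uniform_bound
  refine ⟨3 * (4 * P.deg : ℕ) ^ 2 * K ^ 6 * (2 * K), by positivity, fun n hn t ht => ?_⟩
  obtain ⟨R, hR⟩ : ∃ R, R = n ^ (2 * (P.deg + 1)) := ⟨_, rfl⟩
  have hn0 : 0 < n := by linarith
  have hR0 : 0 < R := by rw [hR]; positivity
  rw [← hR]
  obtain ⟨N, hNdef⟩ : ∃ N, N = ∫ x in Ioi (0:ℝ), S.vt t x ^ 2 := ⟨_, rfl⟩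
  rw [← hNdef]
  have hN : 0 ≤ N := hNdef ▸ integral_nonneg fun x => sq_nonneg _
  obtain ⟨G, hG⟩ : ∃ G : ℝ, G = 3 * (4 * P.deg : ℕ) ^ 2 * K ^ 6 / n := ⟨_, rfl⟩
  have hG0 : 0 ≤ G := by rw [hG]; positivity
  have hpt : ∀ x ∈ Icc 0 R,
      ‖-((4 * P.deg : ℕ) / R * (1 - x / R) ^ (4 * P.deg - 1)) * S.energyFlux t x
        + (4 * P.deg : ℕ) * (4 * P.deg - 1 : ℕ) / R ^ 2 * (1 - x / R) ^ (4 * P.deg - 2)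
          * (S.massFlux t x * S.capFlux t x)‖
      ≤ G * ((1 + N) * (2 * K) * S.cutoffDensity R t x + (S.vt t x ^ 2 + N / R)) := by
    intro x hx
    have hx0 : x ∈ Ici (0:ℝ) := hx.1
    obtain ⟨b1, b2, b3, b4, b5, b6, b7⟩ := hbd t ht x hx0
    have hθ := cutoff_mem_Icc hR0 hx
    have hq : 0 ≤ S.r t x ^ P.deg := pow_nonneg (r_pos ht hx0).le _
    have hmass := S.massFlux_sq_le ht hx0
    rw [← hNdef] at hmass
    have hv0 := S.v_pos t ht x hx0
    have hqu : S.massFlux t x = S.r t x ^ P.deg * S.u t x := by rw [massFlux, r_rpow_m]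
    have hcap : S.capFlux t x = S.v t x ^ (-(P.β + 5)) * S.r t x ^ P.deg
        * (S.r t x ^ P.deg * S.vx t x) := by rw [capFlux, r_rpow_two_m]; ring
    have hkort : S.kortStress t x = (P.β + 5) / 2 * S.v t x ^ (-(P.β + 6))
        * (S.r t x ^ P.deg * S.vx t x) ^ 2 := by rw [kortStress, r_rpow_two_m]; ring
    have hw : (S.r t x ^ P.deg * S.u t x) ^ 2 ≤ R * N := by
      rw [← hqu]
      exact hmass.trans (mul_le_mul_of_nonneg_right hx.2 hN)
    have hu : S.u t x ^ 2 ≤ K * N := by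
      have hq0 : 0 < (S.r t x ^ P.deg) ^ 2 := by
        have := r_pos (S := S) ht hx0
        positivity
      refine le_of_mul_le_mul_left (a := (S.r t x ^ P.deg) ^ 2) ?_ hq0
      rw [hqu] at hmass
      calc (S.r t x ^ P.deg) ^ 2 * S.u t x ^ 2 = (S.r t x ^ P.deg * S.u t x) ^ 2 := by ring
        _ ≤ x * N := hmass
        _ ≤ K * (S.r t x ^ P.deg) ^ 2 * N := by gcongr
        _ = _ := by ring
    have h := abs_cutoff_error_le P.one_le_deg hK hn hR hθ.1 hθ.2 hN hq
      (b7 n hn (hx.2.trans_eq hR)) hw hu b5 b4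
      ((abs_of_pos (Real.rpow_pos_of_pos hv0 _)).trans_le b1) b3 (z := S.vx t x)
      (b₅ := S.v t x ^ (-(P.β + 5)))
    rw [Real.norm_eq_abs, energyFlux, hqu, hcap, hkort]
    refine h.trans ?_
    rw [← hG]
    refine mul_le_mul_of_nonneg_left ?_ hG0
    have hen := mul_le_mul_of_nonneg_left (S.energy_lower_bound hγ ht hx0 hK b2)
      (pow_nonneg hθ.1 (4 * P.deg))
    rw [add_assoc]
    refine add_le_add ?_ le_rfl
    rw [mul_assoc]
    refine mul_le_mul_of_nonneg_left ?_ (by linarith)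
    unfold cutoffDensity
    nlinarith [sq_nonneg (S.v t x - 1), sq_nonneg (S.vx t x)]
  have cD := continuousOn_slice (S.cont_cutoffDensity hT R) ht
  have iD := intervalIntegrable_of_continuousOn_Ici cD hR0.le
  have iv : IntervalIntegrable (fun x => S.vt t x ^ 2) volume 0 R :=
    intervalIntegrable_of_continuousOn_Ici ((continuousOn_slice S.cont_vt ht).pow 2) hR0.le
  have hint := intervalIntegral.norm_integral_le_of_norm_le hR0.le
    (ae_of_all _ fun x hx => hpt x (Ioc_subset_Icc_self hx))
    (((iD.const_mul ((1 + N) * (2 * K))).add (iv.add intervalIntegrable_const)).const_mul G)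
  rw [intervalIntegral.integral_const_mul, intervalIntegral.integral_add
    (iD.const_mul ((1 + N) * (2 * K))) (iv.add intervalIntegrable_const),
    intervalIntegral.integral_const_mul, intervalIntegral.integral_add iv intervalIntegrable_const,
    intervalIntegral.integral_const, smul_eq_mul, sub_zero, mul_div_cancel₀ _ hR0.ne'] at hint
  refine hint.trans ?_
  have hNle := integral_sq_le_Ioi (S.int_vt t ht) hR0.le
  rw [← hNdef] at hNle
  rw [show 3 * (4 * P.deg : ℕ) ^ 2 * K ^ 6 * (2 * K) / n = G * (2 * K) by rw [hG]; ring, mul_assoc G]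
  refine mul_le_mul_of_nonneg_left ?_ hG0
  nlinarith

lemma integrableOn_energy {t : ℝ} (ht : t ∈ Icc (0:ℝ) T) :
    IntegrableOn (S.energy t) (Ioi 0) := by
  refine (((S.int_Phi t ht).add ((S.int_u t ht).div_const 2)).add
    ((S.int_wvxB t ht).div_const 2)).congr (ae_of_all _ fun x => ?_)
  simp only [energy, Pi.add_apply]
  rw [div_div, mul_comm (S.v t x ^ (P.β + 5)) 2]

lemma integral_cutoff_energyRate_eq {t R : ℝ} (ht : t ∈ Ioo (0:ℝ) T) (hR : 0 < R) :
    ∫ x in (0:ℝ)..R, (1 - x / R) ^ (4 * P.deg) * S.energyRate t x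
      = -(∫ x in (0:ℝ)..R, (1 - x / R) ^ (4 * P.deg) * S.dissipation t x)
        - S.cutoffError R t := by
  have he := P.one_le_deg
  refine S.integral_cutoff_energyRate ht hR.le (hasDerivAt_cutoff (4 * P.deg) R)
    (hasDerivAt_cutoff_deriv (4 * P.deg) R) (by fun_prop) ?_ ?_
  · rw [div_self hR.ne', sub_self, zero_pow (by omega)]
  · rw [div_self hR.ne', sub_self, zero_pow (by omega), mul_zero, neg_zero]

lemma cutoffDensity_nonneg (hγ : 0 ≤ P.γ) {R t x : ℝ} (hR : 0 < R) (ht : t ∈ Icc (0:ℝ) T)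
    (hx : x ∈ Icc 0 R) : 0 ≤ S.cutoffDensity R t x :=
  add_nonneg (mul_nonneg (pow_nonneg (cutoff_mem_Icc hR hx).1 _) (S.energy_nonneg hγ ht hx.1))
    (add_nonneg (sq_nonneg _) (sq_nonneg _))

lemma hasDerivAt_integral_cutoffDensity {R t : ℝ} (hR : 0 < R) (ht : t ∈ Ioo (0:ℝ) T) :
    HasDerivAt (fun τ => ∫ x in (0:ℝ)..R, S.cutoffDensity R τ x)
      (-(∫ x in (0:ℝ)..R, (1 - x / R) ^ (4 * P.deg) * S.dissipation t x) - S.cutoffError R t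
        + ∫ x in (0:ℝ)..R, (2 * (S.v t x - 1) * S.vt t x + 2 * S.vx t x * S.vtx t x)) t := by
  have hT : 0 ≤ T := (ht.1.trans ht.2).le
  have ht' := Ioo_subset_Icc_self ht
  have c1 : ContinuousOn (fun p : ℝ × ℝ => (1 - p.2 / R) ^ (4 * P.deg) * S.energyRate p.1 p.2)
      (Icc (0:ℝ) T ×ˢ Ici (0:ℝ)) := ContinuousOn.mul (by fun_prop) (S.cont_energyRate hT)
  have c2 : ContinuousOn (fun p : ℝ × ℝ => 2 * (S.v p.1 p.2 - 1) * S.vt p.1 p.2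
      + 2 * S.vx p.1 p.2 * S.vtx p.1 p.2) (Icc (0:ℝ) T ×ˢ Ici (0:ℝ)) :=
    ((continuousOn_const.mul (S.cont_v.sub continuousOn_const)).mul S.cont_vt).add
      ((continuousOn_const.mul S.cont_vx).mul S.cont_vtx)
  have h := hasDerivAt_integral_slice (f := S.cutoffDensity R)
    (ft := fun t x => (1 - x / R) ^ (4 * P.deg) * S.energyRate t x
      + (2 * (S.v t x - 1) * S.vt t x + 2 * S.vx t x * S.vtx t x)) hR.le
    (S.cont_cutoffDensity hT R) (c1.add c2) (fun τ hτ x hx => by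
      refine ((S.hasDerivAt_energy hτ hx).const_mul ((1 - x / R) ^ (4 * P.deg))).add
        ((((S.hvt τ hτ x hx).sub_const 1).pow 2).add ((S.hvtx τ hτ x hx).pow 2)) |>.congr_deriv ?_
      simp) ht
  rw [intervalIntegral.integral_add
    (intervalIntegrable_of_continuousOn_Ici
      (continuousOn_slice (f := fun t x => (1 - x / R) ^ (4 * P.deg) * S.energyRate t x) c1 ht')
      hR.le)
    (intervalIntegrable_of_continuousOn_Ici
      (continuousOn_slice (f := fun t x => 2 * (S.v t x - 1) * S.vt t x
        + 2 * S.vx t x * S.vtx t x) c2 ht') hR.le),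
    S.integral_cutoff_energyRate_eq ht hR] at h
  exact h

lemma integral_lowerOrder_le (hγ : 0 ≤ P.γ) {R t : ℝ} (hR : 0 < R) (ht : t ∈ Icc (0:ℝ) T) :
    ∫ x in (0:ℝ)..R, (2 * (S.v t x - 1) * S.vt t x + 2 * S.vx t x * S.vtx t x)
      ≤ (∫ x in (0:ℝ)..R, S.cutoffDensity R t x) + (∫ x in Ioi (0:ℝ), S.vt t x ^ 2)
        + ∫ x in Ioi (0:ℝ), S.vtx t x ^ 2 := by
  have hT : 0 ≤ T := ht.1.trans ht.2
  have cv := continuousOn_slice S.cont_v ht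
  have cvt := continuousOn_slice S.cont_vt ht
  have cvx := continuousOn_slice S.cont_vx ht
  have cvtx := continuousOn_slice S.cont_vtx ht
  have i0 := intervalIntegrable_of_continuousOn_Ici
    (continuousOn_slice (S.cont_cutoffDensity hT R) ht) hR.le
  have i1 : IntervalIntegrable (fun x => S.vt t x ^ 2) volume 0 R :=
    intervalIntegrable_of_continuousOn_Ici (cvt.pow 2) hR.le
  have i2 : IntervalIntegrable (fun x => S.vtx t x ^ 2) volume 0 R :=
    intervalIntegrable_of_continuousOn_Ici (cvtx.pow 2) hR.le
  have i3 : IntervalIntegrable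
      (fun x => 2 * (S.v t x - 1) * S.vt t x + 2 * S.vx t x * S.vtx t x) volume 0 R :=
    intervalIntegrable_of_continuousOn_Ici
      (((continuousOn_const.mul (cv.sub continuousOn_const)).mul cvt).add
        ((continuousOn_const.mul cvx).mul cvtx)) hR.le
  calc _ ≤ ∫ x in (0:ℝ)..R, (S.cutoffDensity R t x + S.vt t x ^ 2 + S.vtx t x ^ 2) := by
        refine intervalIntegral.integral_mono_on hR.le i3 ((i0.add i1).add i2) fun x hx => ?_
        have h1 := mul_nonneg (pow_nonneg (cutoff_mem_Icc hR hx).1 (4 * P.deg))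
          (S.energy_nonneg hγ ht hx.1)
        unfold cutoffDensity
        linarith [two_mul_le_add_sq (S.v t x - 1) (S.vt t x),
          two_mul_le_add_sq (S.vx t x) (S.vtx t x)]
    _ = (∫ x in (0:ℝ)..R, S.cutoffDensity R t x) + (∫ x in (0:ℝ)..R, S.vt t x ^ 2)
        + ∫ x in (0:ℝ)..R, S.vtx t x ^ 2 := by
      rw [intervalIntegral.integral_add (i0.add i1) i2, intervalIntegral.integral_add i0 i1]
    _ ≤ _ := add_le_add (add_le_add le_rfl (integral_sq_le_Ioi (S.int_vt t ht) hR.le))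
      (integral_sq_le_Ioi (S.int_vtx t ht) hR.le)

lemma integral_cutoffDensity_le {R t : ℝ} (hR : 0 < R) (ht : t ∈ Icc (0:ℝ) T) :
    ∫ x in (0:ℝ)..R, S.cutoffDensity R t x
      ≤ (∫ x in Ioi (0:ℝ), ‖S.energy t x‖) + (∫ x in Ioi (0:ℝ), (S.v t x - 1) ^ 2)
        + ∫ x in Ioi (0:ℝ), S.vx t x ^ 2 := by
  have hT : 0 ≤ T := ht.1.trans ht.2
  have i0 : IntervalIntegrable (fun x => (1 - x / R) ^ (4 * P.deg) * S.energy t x) volume 0 R :=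
    intervalIntegrable_of_continuousOn_Ici
      (ContinuousOn.mul (by fun_prop) (continuousOn_slice (S.cont_energy hT) ht)) hR.le
  have i1 : IntervalIntegrable (fun x => (S.v t x - 1) ^ 2) volume 0 R :=
    intervalIntegrable_of_continuousOn_Ici
      (((continuousOn_slice S.cont_v ht).sub continuousOn_const).pow 2) hR.le
  have i2 : IntervalIntegrable (fun x => S.vx t x ^ 2) volume 0 R :=
    intervalIntegrable_of_continuousOn_Ici ((continuousOn_slice S.cont_vx ht).pow 2) hR.le
  simp only [cutoffDensity]
  rw [intervalIntegral.integral_add i0 (i1.add i2), intervalIntegral.integral_add i1 i2, ← add_assoc]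
  exact add_le_add (add_le_add ((le_abs_self _).trans
    (norm_integral_cutoff_le (4 * P.deg) (S.integrableOn_energy ht) hR))
    (integral_sq_le_Ioi (S.int_v1 t ht) hR.le)) (integral_sq_le_Ioi (S.int_vx t ht) hR.le)

/-- The localized energy is bounded uniformly in time and in the cutoff. -/
lemma exists_integral_cutoffDensity_le (hT : 0 ≤ T) (hγ : 0 ≤ P.γ) :
    ∃ M : ℝ, ∀ n : ℝ, 1 ≤ n → ∀ t ∈ Icc (0:ℝ) T,
      1 + ∫ x in (0:ℝ)..n ^ (2 * (P.deg + 1)), S.cutoffDensity (n ^ (2 * (P.deg + 1))) t x ≤ M := by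
  obtain ⟨C, hC, herr⟩ := S.exists_abs_cutoffError_le hT hγ
  obtain ⟨g, hg⟩ : ∃ g : ℝ → ℝ, g = fun t => (C + 1) * (1 + (∫ x in Ioi (0:ℝ), S.vt t x ^ 2)
      + ∫ x in Ioi (0:ℝ), S.vtx t x ^ 2) := ⟨_, rfl⟩
  refine ⟨(1 + ((∫ x in Ioi (0:ℝ), ‖S.energy 0 x‖) + (∫ x in Ioi (0:ℝ), (S.v 0 x - 1) ^ 2)
    + ∫ x in Ioi (0:ℝ), S.vx 0 x ^ 2)) * Real.exp (∫ t in (0:ℝ)..T, g t), fun n hn t ht => ?_⟩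
  have hn0 : 0 < n := by linarith
  have hR : 0 < n ^ (2 * (P.deg + 1)) := by positivity
  have hNnn : ∀ f : ℝ → ℝ, 0 ≤ ∫ x in Ioi (0:ℝ), f x ^ 2 := fun f =>
    integral_nonneg fun x => sq_nonneg _
  have hYnn : ∀ s ∈ Icc 0 T, 0 ≤ ∫ x in (0:ℝ)..n ^ (2 * (P.deg + 1)),
      S.cutoffDensity (n ^ (2 * (P.deg + 1))) s x := fun s hs =>
    intervalIntegral.integral_nonneg hR.le fun x hx => S.cutoffDensity_nonneg hγ hR hs hx
  refine (one_add_le_exp_integral (g := g)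
    (continuousOn_integral_slice hR.le hT (S.cont_cutoffDensity hT _)) hYnn
    (fun s hs => S.hasDerivAt_integral_cutoffDensity hR hs) (fun s hs => ?_) ?_
    (fun s _ => ?_) ht).trans ?_
  · have hs' := Ioo_subset_Icc_self hs
    have h1 := (neg_le_abs _).trans (herr n hn s hs')
    have h2 := S.integral_lowerOrder_le hγ hR hs'
    have h3 : 0 ≤ ∫ x in (0:ℝ)..n ^ (2 * (P.deg + 1)),
        (1 - x / n ^ (2 * (P.deg + 1))) ^ (4 * P.deg) * S.dissipation s x :=
      intervalIntegral.integral_nonneg hR.le fun x hx =>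
        mul_nonneg (pow_nonneg (cutoff_mem_Icc hR hx).1 _) (S.dissipation_nonneg hs' hx.1)
    have h4 := hYnn s hs'
    have h5 := hNnn (S.vt s)
    have h6 := hNnn (S.vtx s)
    have h7 : C / n ≤ C := div_le_self hC hn
    rw [hg]
    simp only
    generalize (∫ x in (0:ℝ)..n ^ (2 * (P.deg + 1)),
      S.cutoffDensity (n ^ (2 * (P.deg + 1))) s x) = Y at *
    generalize (∫ x in Ioi (0:ℝ), S.vt s x ^ 2) = N at *
    generalize (∫ x in Ioi (0:ℝ), S.vtx s x ^ 2) = N' at *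
    have h8 : C / n * ((1 + N) * (1 + Y)) ≤ C * ((1 + N) * (1 + Y)) :=
      mul_le_mul_of_nonneg_right h7 (by positivity)
    have h9 : 0 ≤ C * N' * (1 + Y) := by positivity
    have h10 : 0 ≤ (N + N') * Y := by positivity
    linarith
  · rw [hg]
    exact ((intervalIntegrable_const.add S.tint_vt).add S.tint_vtx).const_mul _
  · rw [hg]
    have h5 := hNnn (S.vt s)
    have h6 := hNnn (S.vtx s)
    simp only
    positivity
  · refine mul_le_mul_of_nonneg_right ?_ (Real.exp_pos _).le
    have := S.integral_cutoffDensity_le hR (left_mem_Icc.2 hT)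
    linarith

/-- The localized energy balance. -/
lemma cutoff_energy_balance {R t : ℝ} (hR : 0 < R) (ht : t ∈ Icc (0:ℝ) T) :
    (∫ x in (0:ℝ)..R, (1 - x / R) ^ (4 * P.deg) * S.energy t x)
      + (∫ τ in (0:ℝ)..t, ∫ x in (0:ℝ)..R, (1 - x / R) ^ (4 * P.deg) * S.dissipation τ x)
      + (∫ τ in (0:ℝ)..t, S.cutoffError R τ)
      = ∫ x in (0:ℝ)..R, (1 - x / R) ^ (4 * P.deg) * S.energy 0 x := by
  have hT : 0 ≤ T := ht.1.trans ht.2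
  have hsub : Icc 0 t ⊆ Icc 0 T := Icc_subset_Icc_right ht.2
  have cE : ContinuousOn (fun p : ℝ × ℝ => (1 - p.2 / R) ^ (4 * P.deg) * S.energy p.1 p.2)
      (Icc (0:ℝ) T ×ˢ Ici (0:ℝ)) := ContinuousOn.mul (by fun_prop) (S.cont_energy hT)
  have cR : ContinuousOn (fun p : ℝ × ℝ => (1 - p.2 / R) ^ (4 * P.deg) * S.energyRate p.1 p.2)
      (Icc (0:ℝ) T ×ˢ Ici (0:ℝ)) := ContinuousOn.mul (by fun_prop) (S.cont_energyRate hT)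
  have cD : ContinuousOn (fun p : ℝ × ℝ => (1 - p.2 / R) ^ (4 * P.deg) * S.dissipation p.1 p.2)
      (Icc (0:ℝ) T ×ˢ Ici (0:ℝ)) := ContinuousOn.mul (by fun_prop) S.cont_dissipation
  have cE' := (continuousOn_integral_slice (f := fun t x => (1 - x / R) ^ (4 * P.deg)
    * S.energy t x) hR.le hT cE).mono hsub
  have iD : IntervalIntegrable (fun τ => ∫ x in (0:ℝ)..R,
      (1 - x / R) ^ (4 * P.deg) * S.dissipation τ x) volume 0 t :=
    ((continuousOn_integral_slice (f := fun t x => (1 - x / R) ^ (4 * P.deg)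
      * S.dissipation t x) hR.le hT cD).mono hsub).intervalIntegrable_of_Icc ht.1
  have iJ : IntervalIntegrable (S.cutoffError R) volume 0 t :=
    ((continuousOn_integral_slice hR.le hT (f := fun t x =>
      -((4 * P.deg : ℕ) / R * (1 - x / R) ^ (4 * P.deg - 1)) * S.energyFlux t x
      + (4 * P.deg : ℕ) * (4 * P.deg - 1 : ℕ) / R ^ 2 * (1 - x / R) ^ (4 * P.deg - 2)
        * (S.massFlux t x * S.capFlux t x))
      (S.cont_cutoffErrorIntegrand hT R)).mono hsub).intervalIntegrable_of_Icc ht.1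
  have h := intervalIntegral.integral_eq_sub_of_hasDerivAt_of_le ht.1 cE' (fun τ hτ => by
    have hτ' : τ ∈ Ioo 0 T := ⟨hτ.1, hτ.2.trans_le ht.2⟩
    have := hasDerivAt_integral_slice (f := fun t x => (1 - x / R) ^ (4 * P.deg) * S.energy t x)
      (ft := fun t x => (1 - x / R) ^ (4 * P.deg) * S.energyRate t x) hR.le cE cR
      (fun s hs x hx => (S.hasDerivAt_energy hs hx).const_mul _) hτ'
    rwa [S.integral_cutoff_energyRate_eq hτ' hR] at this) (iD.neg.sub iJ)
  rw [intervalIntegral.integral_sub iD.neg iJ] at h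
  simp only [Pi.neg_apply, intervalIntegral.integral_neg] at h
  linarith

lemma tendsto_integral_cutoffError (hT : 0 ≤ T) (hγ : 0 ≤ P.γ) {t : ℝ} (ht : t ∈ Icc (0:ℝ) T) :
    Tendsto (fun i : ℕ => ∫ τ in (0:ℝ)..t, S.cutoffError (((i:ℝ) + 1) ^ (2 * (P.deg + 1))) τ)
      atTop (𝓝 0) := by
  obtain ⟨C, hC, herr⟩ := S.exists_abs_cutoffError_le hT hγ
  obtain ⟨M, hM⟩ := S.exists_integral_cutoffDensity_le hT hγ
  have hsub : uIcc 0 t ⊆ uIcc 0 T := by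
    rw [uIcc_of_le ht.1, uIcc_of_le hT]; exact Icc_subset_Icc_right ht.2
  have iN : IntervalIntegrable (fun τ => 1 + ∫ x in Ioi (0:ℝ), S.vt τ x ^ 2) volume 0 t :=
    (intervalIntegrable_const.add S.tint_vt).mono_set hsub
  refine squeeze_zero_norm (a := fun i : ℕ => 1 / ((i:ℝ) + 1)
    * (C * ((∫ τ in (0:ℝ)..t, (1 + ∫ x in Ioi (0:ℝ), S.vt τ x ^ 2)) * M))) (fun i => ?_) ?_
  · have hn : (1:ℝ) ≤ (i:ℝ) + 1 := by linarith [(Nat.cast_nonneg i : (0:ℝ) ≤ i)]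
    have hn0 : (0:ℝ) < (i:ℝ) + 1 := by linarith
    have h := intervalIntegral.norm_integral_le_of_norm_le (μ := volume)
      (f := S.cutoffError (((i:ℝ) + 1) ^ (2 * (P.deg + 1))))
      (g := fun τ => C / ((i:ℝ) + 1) * ((1 + ∫ x in Ioi (0:ℝ), S.vt τ x ^ 2) * M)) ht.1
      (ae_of_all _ fun τ hτ => by
        have hτ' : τ ∈ Icc 0 T := ⟨hτ.1.le, hτ.2.trans ht.2⟩
        refine (herr _ hn τ hτ').trans ?_
        have : 0 ≤ ∫ x in Ioi (0:ℝ), S.vt τ x ^ 2 := integral_nonneg fun x => sq_nonneg _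
        gcongr
        exact hM _ hn τ hτ')
      ((iN.mul_const M).const_mul _)
    refine h.trans_eq ?_
    rw [intervalIntegral.integral_const_mul, intervalIntegral.integral_mul_const]
    ring
  · simpa using tendsto_one_div_add_atTop_nhds_zero_nat.mul_const
      (C * ((∫ τ in (0:ℝ)..t, (1 + ∫ x in Ioi (0:ℝ), S.vt τ x ^ 2)) * M))

/-- The energy identity. -/
lemma energy_identity (hT : 0 ≤ T) (hγ : 0 ≤ P.γ) {t : ℝ} (ht : t ∈ Icc (0:ℝ) T) :
    (∫ x in Ioi (0:ℝ), S.energy t x)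
      + (∫ τ in (0:ℝ)..t, ∫ x in Ioi (0:ℝ), S.dissipation τ x)
      = ∫ x in Ioi (0:ℝ), S.energy 0 x := by
  obtain ⟨R, hRdef⟩ : ∃ R : ℕ → ℝ, R = fun i : ℕ => ((i:ℝ) + 1) ^ (2 * (P.deg + 1)) := ⟨_, rfl⟩
  have hR : ∀ i, 0 < R i := fun i => by rw [hRdef]; positivity
  have hlim : Tendsto R atTop atTop := by
    rw [hRdef]
    exact (tendsto_pow_atTop (by omega)).comp
      (tendsto_atTop_add_const_right _ _ tendsto_natCast_atTop_atTop)
  have hsub : Icc 0 t ⊆ Icc 0 T := Icc_subset_Icc_right ht.2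
  have hdint : ∀ τ ∈ Icc 0 T, IntegrableOn (S.dissipation τ) (Ioi 0) := S.int_diss
  have hdt : IntervalIntegrable (fun τ => ∫ x in Ioi (0:ℝ), S.dissipation τ x) volume 0 t :=
    IntervalIntegrable.mono_set S.tint_diss (by
      rw [uIcc_of_le ht.1, uIcc_of_le hT]; exact hsub)
  have l1 := tendsto_integral_cutoff (4 * P.deg) (S.integrableOn_energy ht) hR hlim
  have l0 := tendsto_integral_cutoff (4 * P.deg)
    (S.integrableOn_energy (left_mem_Icc.2 hT)) hR hlim
  have l2 : Tendsto (fun i => ∫ τ in (0:ℝ)..t, ∫ x in (0:ℝ)..R i,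
      (1 - x / R i) ^ (4 * P.deg) * S.dissipation τ x) atTop
      (𝓝 (∫ τ in (0:ℝ)..t, ∫ x in Ioi (0:ℝ), S.dissipation τ x)) := by
    refine intervalIntegral.tendsto_integral_filter_of_dominated_convergence
      (fun τ => ∫ x in Ioi (0:ℝ), S.dissipation τ x) (Eventually.of_forall fun i => ?_)
      (Eventually.of_forall fun i => ae_of_all _ fun τ hτ => ?_) hdt
      (ae_of_all _ fun τ hτ => ?_)
    · have cD : ContinuousOn (fun p : ℝ × ℝ => (1 - p.2 / R i) ^ (4 * P.deg)
          * S.dissipation p.1 p.2) (Icc (0:ℝ) T ×ˢ Ici (0:ℝ)) :=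
        ContinuousOn.mul (by fun_prop) S.cont_dissipation
      rw [uIoc_of_le ht.1]
      exact (((continuousOn_integral_slice (f := fun t x => (1 - x / R i) ^ (4 * P.deg)
        * S.dissipation t x) (hR i).le hT cD).mono hsub).mono
          Ioc_subset_Icc_self).aestronglyMeasurable measurableSet_Ioc
    · rw [uIoc_of_le ht.1] at hτ
      have hτ' := hsub (Ioc_subset_Icc_self hτ)
      refine (norm_integral_cutoff_le (4 * P.deg) (hdint τ hτ') (hR i)).trans_eq ?_
      exact setIntegral_congr_fun measurableSet_Ioi fun x hx =>
        Real.norm_of_nonneg (S.dissipation_nonneg hτ' (mem_Ici.2 (le_of_lt hx)))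
    · rw [uIoc_of_le ht.1] at hτ
      exact tendsto_integral_cutoff (4 * P.deg) (hdint τ (hsub (Ioc_subset_Icc_self hτ))) hR hlim
  have l3 : Tendsto (fun i => ∫ τ in (0:ℝ)..t, S.cutoffError (R i) τ) atTop (𝓝 0) := by
    rw [hRdef]
    exact S.tendsto_integral_cutoffError hT hγ ht
  have l4 := ((l1.add l2).add l3).congr fun i => S.cutoff_energy_balance (hR i) ht
  rw [add_zero] at l4
  exact tendsto_nhds_unique l4 l0

lemma vx_zero_eq (hT : 0 ≤ T) {x : ℝ} (hx : 0 < x) : S.vx 0 x = deriv v₀ x := by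
  have h := S.hvx 0 (left_mem_Icc.2 hT) x hx.le
  refine (HasDerivAt.deriv (h.congr_of_eventuallyEq ?_)).symm
  filter_upwards [Ioi_mem_nhds hx] with y hy
  exact (S.init_v y (mem_Ici.2 (le_of_lt hy))).symm

end SolK

/-- **Lemma 2.1** (basic energy identity for the Kazhikhov model).  By the mass equation,
`S.vt = (r^m u)_x`. -/
theorem basic_energy_identity_kazhikhov (P : KParams) (hγ : 1 ≤ P.γ) (v₀ u₀ : ℝ → ℝ)
    (Vlo Vhi : ℝ) (hID : InitData1 P v₀ u₀ Vlo Vhi) (T : ℝ) (hT : 0 < T)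
    (S : SolK P T v₀ u₀) :
    ∀ t ∈ Icc (0:ℝ) T,
      (∫ x in Ioi (0:ℝ),
          (Phi P.γ (S.v t x) + S.u t x ^ 2 / 2
            + S.r t x ^ (2 * P.m) * S.vx t x ^ 2 / (2 * S.v t x ^ (P.β + 5))))
        + (∫ τ in (0:ℝ)..t, ∫ x in Ioi (0:ℝ),
            (2 * P.mu + P.lam * S.v τ x ^ (-P.α)) * S.vt τ x ^ 2 / S.v τ x)
      = ∫ x in Ioi (0:ℝ),
          (Phi P.γ (v₀ x) + u₀ x ^ 2 / 2
            + S.r 0 x ^ (2 * P.m) * deriv v₀ x ^ 2 / (2 * v₀ x ^ (P.β + 5))) := by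
  intro t ht
  have h := S.energy_identity hT.le (zero_le_one.trans hγ) ht
  refine h.trans (setIntegral_congr_fun measurableSet_Ioi fun x hx => ?_)
  have hx' : x ∈ Ici (0:ℝ) := mem_Ici.2 (le_of_lt hx)
  simp only [SolK.energy]
  rw [S.init_v x hx', S.init_u x hx', S.vx_zero_eq hT.le hx]
end
end

section
/- Let γ ≥ 1 and define Φ(v) = ∫₁^v (1 − s^{−γ}) ds for v > 0. Then there exists a constant c₀ > 0, depending only on γ, such that Φ(v) ≥ c₀ (1−v)²/(1+v) for all v > 0. -/
open MeasureTheory Real Filter Topology Set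

noncomputable section

/-- The integral of `1 - s⁻¹` from `1` to `v` bounds `Phi γ v` from below when `γ ≥ 1`. -/
theorem sub_one_sub_log_le_Phi {γ v : ℝ} (hγ : 1 ≤ γ) (hv : 0 < v) :
    v - 1 - log v ≤ Phi γ v := by
  have h0 : (0 : ℝ) ∉ uIcc 1 v := notMem_uIcc_of_lt one_pos hv
  have hinv : IntervalIntegrable (fun s : ℝ => s⁻¹) volume 1 v :=
    intervalIntegral.intervalIntegrable_inv (fun s hs h => h0 (h ▸ hs)) continuousOn_id
  have hi : IntervalIntegrable (fun s : ℝ => 1 - s⁻¹) volume 1 v :=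
    intervalIntegrable_const.sub hinv
  have hiγ : IntervalIntegrable (fun s : ℝ => 1 - s ^ (-γ)) volume 1 v :=
    intervalIntegrable_const.sub (intervalIntegral.intervalIntegrable_rpow (Or.inr h0))
  have hint : ∫ s in (1 : ℝ)..v, (1 - s⁻¹) = v - 1 - log v := by
    rw [intervalIntegral.integral_sub intervalIntegrable_const hinv, integral_inv h0]
    simp
  rw [← hint, Phi]
  rcases le_total 1 v with h | h
  · refine intervalIntegral.integral_mono_on h hi hiγ fun s hs => ?_
    rw [← rpow_neg_one s]
    have := rpow_le_rpow_of_exponent_le hs.1 (neg_le_neg hγ)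
    linarith
  · rw [intervalIntegral.integral_symm v 1, intervalIntegral.integral_symm v 1]
    refine neg_le_neg (intervalIntegral.integral_mono_on h hiγ.symm hi.symm fun s hs => ?_)
    rw [← rpow_neg_one s]
    have := rpow_le_rpow_of_exponent_ge (hv.trans_le hs.1) hs.2 (neg_le_neg hγ)
    linarith

/-- A quantitative form of `log v ≤ v - 1`. -/
theorem half_mul_sq_div_le_sub_one_sub_log {v : ℝ} (hv : 0 < v) :
    1 / 2 * ((1 - v) ^ 2 / (1 + v)) ≤ v - 1 - log v := by
  obtain ⟨r, hr, rfl⟩ : ∃ r : ℝ, 0 < r ∧ r ^ 2 = v := ⟨√v, sqrt_pos.2 hv, sq_sqrt hv.le⟩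
  have hlog : log (r ^ 2) ≤ 2 * (r - 1) := by
    rw [log_pow]
    push_cast
    linarith [log_le_sub_one_of_pos hr]
  have hsq : 1 / 2 * ((1 - r ^ 2) ^ 2 / (1 + r ^ 2)) ≤ (r - 1) ^ 2 := by
    rw [← mul_div_assoc, div_le_iff₀ (by positivity)]
    nlinarith [sq_nonneg ((r - 1) * (r - 1))]
  linarith

/-- **Lemma 2.2**: `Φ(v) ≥ c₀ (1-v)²/(1+v)` for all `v > 0`, with `c₀` depending only
on `γ ≥ 1`. -/
theorem phi_lower_bound (γ : ℝ) (hγ : 1 ≤ γ) :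
    ∃ c₀ : ℝ, 0 < c₀ ∧ ∀ v : ℝ, 0 < v →
      c₀ * ((1 - v) ^ 2 / (1 + v)) ≤ Phi γ v := by
  exact ⟨1 / 2, by norm_num, fun v hv =>
    (half_mul_sq_div_le_sub_one_sub_log hv).trans (sub_one_sub_log_le_Phi hγ hv)⟩
end
end

section
/- (Analytic core of Kanel's argument.) Let β be a real number with −3 ≤ β ≤ −2, let γ ≥ 1, and let E > 0. Then there exists a constant C ≥ 1, depending only on β, γ and E, such that every continuously differentiable function v : [0,∞) → (0,∞) satisfying v(x) → 1 as x → ∞, ∫₀^∞ Φ(v(x)) dx ≤ E and ∫₀^∞ v′(x)² / v(x)^{β+5} dx ≤ E obeys C⁻¹ ≤ v(x) ≤ C for all x ≥ 0. -/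
open MeasureTheory Real Filter Topology Set

noncomputable section

theorem intervalIntegrable_one_sub_rpow {γ v : ℝ} (hv : 0 < v) :
    IntervalIntegrable (fun s : ℝ => 1 - s ^ (-γ)) volume 1 v := by
  refine ContinuousOn.intervalIntegrable fun s hs => ?_
  have hs0 : 0 < s := (lt_min one_pos hv).trans_le hs.1
  exact (continuousAt_const.sub
    (continuousAt_rpow_const s (-γ) (Or.inl hs0.ne'))).continuousWithinAt

theorem sqrt_sub_one_sq_le_Phi {γ v : ℝ} (hγ : 1 ≤ γ) (hv : 0 < v) :
    (√v - 1) ^ 2 ≤ Phi γ v := by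
  have hlog : log v ≤ 2 * (√v - 1) := by
    have := log_le_sub_one_of_pos (sqrt_pos.2 hv)
    rw [log_sqrt hv.le] at this
    linarith
  nlinarith [sub_one_sub_log_le_Phi hγ hv, sq_sqrt hv.le]

theorem sq_div_one_add_sq_le {u : ℝ} (hu : 0 ≤ u) :
    u ^ 2 / (1 + u ^ 2) ≤ 2 * (1 - exp (-(u / 2))) := by
  have hexp : exp (-(u / 2)) ≤ 2 / (2 + u) := by
    rw [exp_neg, inv_le_comm₀ (exp_pos _) (by positivity), inv_div]
    linarith [add_one_le_exp (u / 2)]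
  have hfrac : u ^ 2 / (1 + u ^ 2) ≤ 2 * (1 - 2 / (2 + u)) := by
    have : 2 * (1 - 2 / (2 + u)) = 2 * u / (2 + u) := by
      field_simp
      ring
    rw [this, div_le_div_iff₀ (by positivity) (by positivity)]
    nlinarith [mul_nonneg hu (sq_nonneg (u - 1))]
  linarith

/-- The weight `(log v)² / (1 + (log v)²)` is dominated by the square root of the potential. -/
theorem weight_sq_mul_rpow_le_Phi {β γ v : ℝ} (hβ₁ : -3 ≤ β) (hβ₂ : β ≤ -2) (hγ : 1 ≤ γ)
    (hv : 0 < v) :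
    (log v ^ 2 / (1 + log v ^ 2)) ^ 2 * v ^ (β + 3) ≤ 4 * Phi γ v := by
  refine le_trans ?_ (mul_le_mul_of_nonneg_left (sqrt_sub_one_sq_le_Phi hγ hv) (by norm_num))
  have hsqrt : exp (log v / 2) = √v := by rw [← log_sqrt hv.le, exp_log (sqrt_pos.2 hv)]
  rcases le_total 1 v with h | h
  · have hc := sq_div_one_add_sq_le (log_nonneg h)
    rw [exp_neg, hsqrt] at hc
    have hpow : v ^ (β + 3) ≤ v := by
      simpa using rpow_le_rpow_of_exponent_le h (by linarith : β + 3 ≤ 1)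
    calc _ ≤ (2 * (1 - (√v)⁻¹)) ^ 2 * v := by gcongr
      _ = (2 * (1 - (√v)⁻¹)) ^ 2 * √v ^ 2 := by rw [sq_sqrt hv.le]
      _ = _ := by field_simp; ring
  · have hc := sq_div_one_add_sq_le (neg_nonneg.2 (log_nonpos hv.le h))
    rw [neg_sq, neg_div, neg_neg, hsqrt] at hc
    have hpow : v ^ (β + 3) ≤ 1 := rpow_le_one hv.le h (by linarith)
    calc _ ≤ (2 * (1 - √v)) ^ 2 * 1 := by gcongr
      _ = _ := by ring

theorem hasDerivAt_sub_arctan (u : ℝ) :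
    HasDerivAt (fun u => u - arctan u) (u ^ 2 / (1 + u ^ 2)) u := by
  have hweight : u ^ 2 / (1 + u ^ 2) = 1 - 1 / (1 + u ^ 2) := by
    field_simp
    ring
  rw [hweight]
  exact (hasDerivAt_id u).sub (hasDerivAt_arctan u)

theorem abs_weight_mul_deriv_le {β γ v d : ℝ} (hβ₁ : -3 ≤ β) (hβ₂ : β ≤ -2) (hγ : 1 ≤ γ)
    (hv : 0 < v) :
    |log v ^ 2 / (1 + log v ^ 2) * (d / v)| ≤ 2 * Phi γ v + d ^ 2 / v ^ (β + 5) := by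
  have hΦ := weight_sq_mul_rpow_le_Phi hβ₁ hβ₂ hγ hv
  set c := log v ^ 2 / (1 + log v ^ 2)
  have hsplit : v ^ (β + 5) = v ^ (β + 3) * v ^ 2 := by
    rw [← rpow_natCast v 2, ← rpow_add hv]
    norm_num
    ring_nf
  have hd : d ^ 2 / v ^ (β + 5) * v ^ (β + 3) = (d / v) ^ 2 := by
    rw [hsplit]
    field_simp
  have hd0 : 0 ≤ d ^ 2 / v ^ (β + 5) := by positivity
  have hamgm : 2 * |c * (d / v)| ≤ c ^ 2 * v ^ (β + 3) + d ^ 2 / v ^ (β + 5) := by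
    refine abs_le_of_sq_le_sq' (?_ : (2 * |c * (d / v)|) ^ 2 ≤ _) (by positivity) |>.2
    rw [mul_pow, sq_abs, mul_pow, ← hd]
    nlinarith [sq_nonneg (c ^ 2 * v ^ (β + 3) - d ^ 2 / v ^ (β + 5))]
  linarith

/-- A function whose derivative is dominated by an integrable function is within the total
integral of its limit at infinity. -/
theorem abs_sub_limit_le_integral {g g' φ : ℝ → ℝ} {l x : ℝ} (hx : 0 ≤ x)
    (hcont : ContinuousOn g (Ici 0)) (hderiv : ∀ y, 0 < y → HasDerivAt g (g' y) y)
    (hφ : IntegrableOn φ (Ioi 0)) (hle : ∀ y, 0 < y → |g' y| ≤ φ y)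
    (hlim : Tendsto g atTop (𝓝 l)) :
    |l - g x| ≤ ∫ y in Ioi (0:ℝ), φ y := by
  have hφ' : IntegrableOn φ (Ici 0) := (integrableOn_Ici_iff_integrableOn_Ioi).2 hφ
  refine le_of_tendsto (hlim.sub_const (g x)).abs ?_
  filter_upwards [eventually_ge_atTop x] with y hy
  have hsub : Icc x y ⊆ Ici 0 := fun z hz => hx.trans hz.1
  have hpos : ∀ z ∈ Ioo x y, 0 < z := fun z hz => hx.trans_lt hz.1
  have htotal : ∫ z in x..y, φ z ≤ ∫ z in Ioi (0:ℝ), φ z := by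
    rw [intervalIntegral.integral_of_le hy]
    refine setIntegral_mono_set hφ ?_ (LE.le.eventuallyLE
      (show Ioc x y ⊆ Ioi 0 from fun z hz => hx.trans_lt hz.1))
    filter_upwards [ae_restrict_mem measurableSet_Ioi] with z hz
    exact (abs_nonneg _).trans (hle z hz)
  have hup := intervalIntegral.sub_le_integral_of_hasDeriv_right_of_le hy (hcont.mono hsub)
    (fun z hz => (hderiv z (hpos z hz)).hasDerivWithinAt) (hφ'.mono_set hsub)
    (fun z hz => (le_abs_self _).trans (hle z (hpos z hz)))
  have hdown := intervalIntegral.sub_le_integral_of_hasDeriv_right_of_le hy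
    (hcont.mono hsub).neg (fun z hz => (hderiv z (hpos z hz)).neg.hasDerivWithinAt)
    (hφ'.mono_set hsub) (fun z hz => (neg_le_abs _).trans (hle z (hpos z hz)))
  simp only [Pi.neg_apply] at hdown
  exact abs_le.2 ⟨by linarith, by linarith⟩

/-- **Analytic core of Kanel's argument** for `-3 ≤ β ≤ -2`. -/
theorem kanel_core (β γ E : ℝ) (hβ₁ : -3 ≤ β) (hβ₂ : β ≤ -2) (hγ : 1 ≤ γ) (hE : 0 < E) :
    ∃ C : ℝ, 1 ≤ C ∧ ∀ v : ℝ → ℝ,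
      (∀ x : ℝ, 0 ≤ x → 0 < v x) →
      ContDiffOn ℝ 1 v (Ici (0:ℝ)) →
      Tendsto v atTop (𝓝 1) →
      IntegrableOn (fun x => Phi γ (v x)) (Ioi (0:ℝ)) →
      (∫ x in Ioi (0:ℝ), Phi γ (v x)) ≤ E →
      IntegrableOn (fun x => deriv v x ^ 2 / v x ^ (β + 5)) (Ioi (0:ℝ)) →
      (∫ x in Ioi (0:ℝ), deriv v x ^ 2 / v x ^ (β + 5)) ≤ E →
      ∀ x : ℝ, 0 ≤ x → C⁻¹ ≤ v x ∧ v x ≤ C := by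
  refine ⟨exp (3 * E + 2), one_le_exp (by positivity), ?_⟩
  intro v hpos hv hlim hΦ hΦE hD hDE x hx
  have hbound : |0 - (log (v x) - arctan (log (v x)))| ≤
      ∫ y in Ioi (0:ℝ), (2 * Phi γ (v y) + deriv v y ^ 2 / v y ^ (β + 5)) := by
    refine abs_sub_limit_le_integral (g := fun y => log (v y) - arctan (log (v y)))
      (g' := fun y => log (v y) ^ 2 / (1 + log (v y) ^ 2) * (deriv v y / v y)) hx ?_ ?_
      ((hΦ.const_mul 2).add hD)
      (fun y hy => abs_weight_mul_deriv_le hβ₁ hβ₂ hγ (hpos y hy.le)) ?_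
    · have hlog := hv.continuousOn.log fun y hy => (hpos y hy).ne'
      exact hlog.sub (continuous_arctan.comp_continuousOn hlog)
    · intro y hy
      have hdv : HasDerivAt v (deriv v y) y :=
        ((hv.differentiableOn one_ne_zero).differentiableAt (Ici_mem_nhds hy)).hasDerivAt
      exact (hasDerivAt_sub_arctan _).comp y (hdv.log (hpos y hy.le).ne')
    · have hlog := hlim.log one_ne_zero
      simpa using hlog.sub ((continuous_arctan.tendsto _).comp hlog)
  rw [integral_add (hΦ.const_mul 2) hD, integral_const_mul] at hbound
  obtain ⟨hl, hu⟩ := abs_le.1 hbound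
  have h₁ := neg_pi_div_two_lt_arctan (log (v x))
  have h₂ := arctan_lt_pi_div_two (log (v x))
  have hπ := pi_le_four
  rw [← exp_neg, ← le_log_iff_exp_le (hpos x hx), ← log_le_iff_le_exp (hpos x hx)]
  constructor <;> linarith
end
end

section
/- Let β be a real number with −3 ≤ β ≤ −2 and define Ῡ(v) = ∫₁^v √(Ψ(s)) s^{−(β+5)/2} ds for v > 0, where Ψ(s) = (1−s)²/(1+s). Then there exist constants A₁ > 0 and A₂ > 0, depending only on β, such that |Ῡ(v)| ≥ A₁ ( v^{−(β+3)/2} + log(1/v) ) − A₂ for all 0 < v ≤ 1, and |Ῡ(v)| ≥ A₁ ( v^{−(β+2)/2} + log v ) − A₂ for all v ≥ 1. -/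
open MeasureTheory Real Filter Topology Set

noncomputable section

/-- `Ψ(s) = (1-s)²/(1+s)`. -/
def Psi (s : ℝ) : ℝ := (1 - s) ^ 2 / (1 + s)

/-- `Ῡ(v) = ∫₁^v √(Ψ(s)) s^(-(β+5)/2) ds`. -/
def Upsilon (β v : ℝ) : ℝ :=
  ∫ s in (1:ℝ)..v, Real.sqrt (Psi s) * s ^ (-(β + 5) / 2)

/-- The integrand of `Ῡ` is continuous on `[a, b] ⊆ (0, ∞)`. -/
theorem continuousOn_upsilon_integrand (p : ℝ) {a b : ℝ} (ha : 0 < a) :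
    ContinuousOn (fun s : ℝ => Real.sqrt (Psi s) * s ^ p) (Icc a b) := by
  have hpos : ∀ s ∈ Icc a b, 0 < s := fun s hs => ha.trans_le hs.1
  refine ContinuousOn.mul (ContinuousOn.sqrt ?_)
    (continuousOn_id.rpow_const fun s hs => Or.inl (hpos s hs).ne')
  unfold Psi
  refine ContinuousOn.div (by fun_prop) (by fun_prop) fun s hs => ?_
  linarith [hpos s hs]

theorem sqrt_Psi_ge_of_le_one {s : ℝ} (hs : 0 < s) (hs1 : s ≤ 1) :
    (1 - s) / 2 ≤ Real.sqrt (Psi s) := by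
  apply Real.le_sqrt_of_sq_le
  rw [Psi, le_div_iff₀ (by linarith)]
  nlinarith [sq_nonneg (1 - s)]

theorem sqrt_Psi_ge_of_one_le {s : ℝ} (hs : 1 ≤ s) :
    (s - 1) / 2 * s ^ (-(1 / 2) : ℝ) ≤ Real.sqrt (Psi s) := by
  have hs0 : 0 < s := by linarith
  apply Real.le_sqrt_of_sq_le
  have h : (s ^ (-(1 / 2) : ℝ)) ^ 2 = s⁻¹ := by
    rw [← Real.rpow_natCast, ← Real.rpow_mul hs0.le]
    norm_num [Real.rpow_neg_one]
  rw [mul_pow, h, Psi, ← div_eq_mul_inv, div_le_div_iff₀ hs0 (by linarith)]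
  nlinarith [sq_nonneg (1 - s)]

/-- For `v ≤ 1` the integral over `[v, 1]` is bounded below by comparison with an explicit
antiderivative. -/
theorem integral_ge_near_zero {a v : ℝ} (ha0 : 0 ≤ a) (ha : a ≤ 1 / 2) (hv : 0 < v)
    (hv1 : v ≤ 1) :
    1 / 4 * (v ^ (-a) + Real.log (1 / v)) - 3 / 2 ≤
      ∫ s in v..1, Real.sqrt (Psi s) * s ^ (-a - 1) := by
  have key := intervalIntegral.sub_le_integral_of_hasDeriv_right_of_le
    (g := fun s : ℝ => 1 / 2 * (1 / 2 * Real.log s - s ^ (-a) - 2 * s ^ (1 / 2 : ℝ)))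
    (g' := fun s : ℝ => 1 / 2 * (1 / 2 * s⁻¹ - -a * s ^ (-a - 1)
      - 2 * (1 / 2 * s ^ (1 / 2 - 1 : ℝ))))
    (φ := fun s : ℝ => Real.sqrt (Psi s) * s ^ (-a - 1)) hv1 ?_ ?_
    ((continuousOn_upsilon_integrand _ hv).integrableOn_Icc) ?_
  · have h1 : 0 ≤ v ^ (1 / 2 : ℝ) := by positivity
    have h2 : 0 < v ^ (-a) := by positivity
    simp only [Real.log_one, Real.one_rpow] at key
    rw [one_div v, Real.log_inv]
    linarith
  · intro s hs
    have h0 : s ≠ 0 := (hv.trans_le hs.1).ne'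
    exact ((((Real.hasDerivAt_log h0).const_mul _).sub
      (Real.hasDerivAt_rpow_const (Or.inl h0))).sub
      ((Real.hasDerivAt_rpow_const (Or.inl h0)).const_mul _)).const_mul _
      |>.continuousAt.continuousWithinAt
  · intro s hs
    have h0 : s ≠ 0 := (hv.trans hs.1).ne'
    exact (((((Real.hasDerivAt_log h0).const_mul _).sub
      (Real.hasDerivAt_rpow_const (Or.inl h0))).sub
      ((Real.hasDerivAt_rpow_const (Or.inl h0)).const_mul _)).const_mul _).hasDerivWithinAt
  · intro s hs
    have h0 : 0 < s := hv.trans hs.1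
    have h1 : s⁻¹ ≤ s ^ (-a - 1) := by
      rw [← Real.rpow_neg_one]
      exact Real.rpow_le_rpow_of_exponent_ge h0 hs.2.le (by linarith)
    have h2 : s ^ (-a) ≤ s ^ (1 / 2 - 1 : ℝ) :=
      Real.rpow_le_rpow_of_exponent_ge h0 hs.2.le (by linarith)
    have h3 : s * s ^ (-a - 1) = s ^ (-a) := by
      rw [Real.rpow_sub_one h0.ne']; field_simp
    have h4 : 0 < s ^ (-a - 1) := by positivity
    have h5 := mul_le_mul_of_nonneg_right (sqrt_Psi_ge_of_le_one h0 hs.2.le) h4.le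
    have h6 := mul_le_mul_of_nonneg_right ha h4.le
    linarith

/-- For `1 ≤ v` the integral over `[1, v]` is bounded below by comparison with an explicit
antiderivative. -/
theorem integral_ge_near_top {b v : ℝ} (hb0 : 0 ≤ b) (hb : b ≤ 1 / 2) (hv1 : 1 ≤ v) :
    1 / 4 * (v ^ b + Real.log v) - 3 / 2 ≤
      ∫ s in (1 : ℝ)..v, Real.sqrt (Psi s) * s ^ (b - 3 / 2) := by
  have key := intervalIntegral.sub_le_integral_of_hasDeriv_right_of_le
    (g := fun s : ℝ => 1 / 2 * (1 / 2 * Real.log s + s ^ b + 2 * s ^ (-(1 / 2) : ℝ)))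
    (g' := fun s : ℝ => 1 / 2 * (1 / 2 * s⁻¹ + b * s ^ (b - 1)
      + 2 * (-(1 / 2) * s ^ (-(1 / 2) - 1 : ℝ))))
    (φ := fun s : ℝ => Real.sqrt (Psi s) * s ^ (b - 3 / 2)) hv1 ?_ ?_
    ((continuousOn_upsilon_integrand _ one_pos).integrableOn_Icc) ?_
  · have hv : 0 < v := by linarith
    have h1 : 0 ≤ v ^ (-(1 / 2) : ℝ) := by positivity
    have h2 : 0 < v ^ b := by positivity
    simp only [Real.log_one, Real.one_rpow] at key
    linarith
  · intro s hs
    have h0 : s ≠ 0 := (one_pos.trans_le hs.1).ne'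
    exact ((((Real.hasDerivAt_log h0).const_mul _).add
      (Real.hasDerivAt_rpow_const (Or.inl h0))).add
      ((Real.hasDerivAt_rpow_const (Or.inl h0)).const_mul _)).const_mul _
      |>.continuousAt.continuousWithinAt
  · intro s hs
    have h0 : s ≠ 0 := (one_pos.trans hs.1).ne'
    exact (((((Real.hasDerivAt_log h0).const_mul _).add
      (Real.hasDerivAt_rpow_const (Or.inl h0))).add
      ((Real.hasDerivAt_rpow_const (Or.inl h0)).const_mul _)).const_mul _).hasDerivWithinAt
  · intro s hs
    have h0 : 0 < s := one_pos.trans hs.1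
    have h1 : s⁻¹ ≤ s ^ (b - 1) := by
      rw [← Real.rpow_neg_one]
      exact Real.rpow_le_rpow_of_exponent_le hs.1.le (by linarith)
    have h2 : s ^ (b - 2) ≤ s ^ (-(1 / 2) - 1 : ℝ) :=
      Real.rpow_le_rpow_of_exponent_le hs.1.le (by linarith)
    have h3 : s ^ (-(1 / 2) : ℝ) * s ^ (b - 3 / 2) = s ^ (b - 2) := by
      rw [← Real.rpow_add h0]; congr 1; ring
    have h4 : s * s ^ (b - 2) = s ^ (b - 1) := by
      rw [show b - 2 = b - 1 - 1 by ring, Real.rpow_sub_one h0.ne' (b - 1)]; field_simp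
    have h5 := mul_le_mul_of_nonneg_right (sqrt_Psi_ge_of_one_le hs.1.le)
      (by positivity : 0 ≤ s ^ (b - 3 / 2))
    rw [mul_assoc, h3] at h5
    have h6 := mul_le_mul_of_nonneg_right hb (by positivity : 0 ≤ s ^ (b - 1))
    linarith

/-- Growth of the Kanel auxiliary function `Ῡ` at `0` and `∞`, for `-3 ≤ β ≤ -2`. -/
theorem upsilon_growth (β : ℝ) (hβ₁ : -3 ≤ β) (hβ₂ : β ≤ -2) :
    ∃ A₁ A₂ : ℝ, 0 < A₁ ∧ 0 < A₂ ∧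
      (∀ v : ℝ, 0 < v → v ≤ 1 →
        A₁ * (v ^ (-(β + 3) / 2) + Real.log (1 / v)) - A₂ ≤ |Upsilon β v|) ∧
      (∀ v : ℝ, 1 ≤ v →
        A₁ * (v ^ (-(β + 2) / 2) + Real.log v) - A₂ ≤ |Upsilon β v|) := by
  refine ⟨1 / 4, 3 / 2, by norm_num, by norm_num, fun v hv hv1 => ?_, fun v hv => ?_⟩
  · have h := integral_ge_near_zero (a := (β + 3) / 2) (by linarith) (by linarith) hv hv1
    rw [← neg_div, show -(β + 3) / 2 - 1 = -(β + 5) / 2 by ring] at h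
    rw [Upsilon, intervalIntegral.integral_symm, abs_neg]
    exact h.trans (le_abs_self _)
  · have h := integral_ge_near_top (b := -(β + 2) / 2) (by linarith) (by linarith) hv
    rw [show -(β + 2) / 2 - 3 / 2 = -(β + 5) / 2 by ring] at h
    exact h.trans (le_abs_self _)
end
end
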